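/- arXiv:2508.18417 — 6 statements merged into one kernel-verified Lean document; each statement's English description precedes it below -/
import Mathlib

section
/- Let r ≥ 1 be an integer and let a, q ∈ ℂ satisfy 1 − a^{2l} q^{2l(l−1)} ≠ 0 for every l = 1,…,r; set λ_l := a^{2l} q^{2l(l−1)}. Let F ∈ ℂ and let (x_j)_{j≥0} be a sequence of complex numbers converging to a limit x_∞ and satisfying, for every j ≥ 0, Σ_{i=0}^{r} (−1)^i e_i(λ_1,…,λ_r) x_{j+r−i} = ( Π_{m=2}^{r} Σ_{i=0}^{m−1} a^{2i} q^{2i(m−1)} ) · F. Then Π_{t=0}^{r−1}(1 − a²q^{2t}) ≠ 0 and x_∞ = F / Π_{t=0}^{r−1}(1 − a²q^{2t}). -/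
open Filter

/-- The `i`-th elementary symmetric polynomial of the family `lam`,
with `e 0 = 1` and `e i = 0` for `i` larger than the number of variables. -/
def esymm {R : Type*} [CommRing R] {n : ℕ} (lam : Fin n → R) (i : ℕ) : R :=
  ∑ t ∈ Finset.powersetCard i (Finset.univ : Finset (Fin n)), ∏ a ∈ t, lam a

theorem sum_neg_one_pow_mul_esymm {R : Type*} [CommRing R] {n : ℕ} (lam : Fin n → R) :
    ∑ i ∈ Finset.range (n + 1), (-1) ^ i * esymm lam i = ∏ t, (1 - lam t) := by
  simp only [sub_eq_add_neg, Finset.prod_one_add, Finset.sum_powerset, Finset.card_univ,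
    Fintype.card_fin]
  refine Finset.sum_congr rfl fun i _ => ?_
  rw [esymm, Finset.mul_sum]
  refine Finset.sum_congr rfl fun t ht => ?_
  rw [Finset.prod_neg, (Finset.mem_powersetCard.mp ht).2]

theorem quantum_int_mul_one_sub {R : Type*} [CommRing R] (a q : R) (t : ℕ) :
    (∑ i ∈ Finset.range (t + 1), a ^ (2 * i) * q ^ (2 * i * t)) * (1 - a ^ 2 * q ^ (2 * t)) =
      1 - a ^ (2 * (t + 1)) * q ^ (2 * (t + 1) * t) := by
  have h := geom_sum_mul_neg (a ^ 2 * q ^ (2 * t)) (t + 1)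
  have e (i : ℕ) : (a ^ 2 * q ^ (2 * t)) ^ i = a ^ (2 * i) * q ^ (2 * i * t) := by
    rw [mul_pow, ← pow_mul, ← pow_mul, mul_right_comm 2 t i]
  simpa only [e] using h

theorem prod_quantum_int_eq_prod_range {R : Type*} [CommRing R] (a q : R) (r : ℕ) :
    ∏ m ∈ Finset.Icc 2 r, ∑ i ∈ Finset.range m, a ^ (2 * i) * q ^ (2 * i * (m - 1)) =
      ∏ t ∈ Finset.range r, ∑ i ∈ Finset.range (t + 1), a ^ (2 * i) * q ^ (2 * i * t) := by
  induction r with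
  | zero => simp
  | succ r ih =>
    rcases Nat.eq_zero_or_pos r with rfl | hr
    · simp
    · rw [Finset.prod_Icc_succ_top (by omega), ih, Finset.prod_range_succ, Nat.add_sub_cancel]

/-- Proposition "infinite twist knot into a link": let `r ≥ 1`, `a q : ℂ` with
`1 - a^{2l} q^{2l(l-1)} ≠ 0` for `l = 1,…,r`, and set `λ_l = a^{2l} q^{2l(l-1)}`.
If a convergent sequence `x_j → x_∞` satisfies the anti-parallel twist recursion
`∑_{i=0}^{r} (-1)^i e_i(λ₁,…,λ_r) x_{j+r-i} = [2]_{aq}⋯[r]_{aq^{r-1}} · F` for all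
`j ≥ 0`, then `(a²;q²)_r ≠ 0` and `x_∞ = F / (a²;q²)_r`. -/
theorem infinite_twist_knot_into_a_link
    (r : ℕ) (hr : 1 ≤ r) (a q : ℂ)
    (hnz : ∀ l : ℕ, 1 ≤ l → l ≤ r → (1 : ℂ) - a ^ (2 * l) * q ^ (2 * l * (l - 1)) ≠ 0)
    (F : ℂ) (x : ℕ → ℂ) (xinf : ℂ)
    (hlim : Tendsto x atTop (nhds xinf))
    (hrec : ∀ j : ℕ,
      ∑ i ∈ Finset.range (r + 1),
        (-1) ^ i *
          esymm (fun t : Fin r => a ^ (2 * ((t : ℕ) + 1)) * q ^ (2 * ((t : ℕ) + 1) * (t : ℕ))) i *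
          x (j + r - i) =
      (∏ m ∈ Finset.Icc 2 r, ∑ i ∈ Finset.range m, a ^ (2 * i) * q ^ (2 * i * (m - 1))) * F) :
    (∏ t ∈ Finset.range r, (1 - a ^ 2 * q ^ (2 * t))) ≠ 0 ∧
    xinf = F / ∏ t ∈ Finset.range r, (1 - a ^ 2 * q ^ (2 * t)) := by
  set P := ∏ t ∈ Finset.range r, (1 - a ^ 2 * q ^ (2 * t)) with hP
  set Q := ∏ m ∈ Finset.Icc 2 r, ∑ i ∈ Finset.range m, a ^ (2 * i) * q ^ (2 * i * (m - 1)) with hQ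
  have hfac : ∏ t : Fin r, (1 - a ^ (2 * ((t : ℕ) + 1)) * q ^ (2 * ((t : ℕ) + 1) * (t : ℕ))) =
      Q * P := by
    rw [hQ, prod_quantum_int_eq_prod_range, hP, ← Finset.prod_mul_distrib,
      Finset.prod_congr rfl fun t _ => quantum_int_mul_one_sub a q t, Finset.prod_range]
  have hQP : Q * P ≠ 0 := by
    rw [← hfac]
    exact Finset.prod_ne_zero_iff.mpr fun t _ => by simpa using hnz (t + 1) (by omega) (by omega)
  have hlim' := tendsto_nhds_unique (tendsto_finsetSum (Finset.range (r + 1)) fun i hi =>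
    (hlim.comp (tendsto_atTop_mono (f := id) (g := fun j => j + r - i)
      (fun j => by have := Finset.mem_range.mp hi; simp only [id]; omega) tendsto_id)).const_mul
      ((-1) ^ i *
        esymm (fun t : Fin r => a ^ (2 * ((t : ℕ) + 1)) * q ^ (2 * ((t : ℕ) + 1) * (t : ℕ))) i))
    (tendsto_const_nhds.congr fun j => (hrec j).symm)
  rw [← Finset.sum_mul, sum_neg_one_pow_mul_esymm, hfac, mul_assoc] at hlim'
  refine ⟨right_ne_zero_of_mul hQP, ?_⟩
  rw [eq_div_iff (right_ne_zero_of_mul hQP), mul_comm]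
  exact mul_left_cancel₀ (left_ne_zero_of_mul hQP) hlim'
end

section
/- Let C be a symmetric m×m integer matrix and let i ≠ j be two of its indices. Then the motivic generating series of the unlinked quiver U(ij)C, with the variable of the new index ν specialized to x_ν = q⁻¹·x_i·x_j, equals the motivic generating series of C. Explicitly, for every dimension vector d ∈ ℕ^m the following identity holds in the field ℚ(q): Σ_{e=0}^{min(d_i,d_j)} (−q)^{(d^e)ᵀ·(U(ij)C)·(d^e)} · q^{−e} / ( (q²;q²)_e · Π_{a=1}^{m} (q²;q²)_{(d^e)_a} ) = (−q)^{dᵀCd} / Π_{a=1}^{m} (q²;q²)_{d_a}, where d^e ∈ ℕ^{m+1} is the dimension vector with (d^e)_a = d_a for a ∉ {i,j}, (d^e)_i = d_i − e, (d^e)_j = d_j − e, and (d^e)_ν = e. -/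
/-- The variable `q` of the field `ℚ(q)` of rational functions. -/
noncomputable def qvar : RatFunc ℚ := RatFunc.X

/-- The q-Pochhammer symbol `(q²;q²)_n = ∏_{t=0}^{n-1} (1 - q² · q^{2t})` in `ℚ(q)`. -/
noncomputable def qPoch (n : ℕ) : RatFunc ℚ :=
  ∏ t ∈ Finset.range n, (1 - qvar ^ (2 * t + 2))

/-- The quadratic form `dᵀ C d` of an integer matrix `C` on a dimension vector `d`. -/
def qform {ι : Type*} [Fintype ι] (C : ι → ι → ℤ) (d : ι → ℕ) : ℤ :=
  ∑ a : ι, ∑ b : ι, (d a : ℤ) * C a b * (d b : ℤ)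

/-- The unlinking `U(ij)C` of a symmetric integer matrix `C` at distinct indices
`i, j`, with the new index `ν` modelled by `Sum.inr ()`: the `(i,j)` entry drops by one
and the new row is `C(i,·) + C(j,·)` with the appropriate `-1` shifts. -/
def unlinkQuiver {m : ℕ} (C : Fin m → Fin m → ℤ) (i j : Fin m) :
    (Fin m ⊕ Unit) → (Fin m ⊕ Unit) → ℤ
  | Sum.inl a, Sum.inl b =>
      if (a = i ∧ b = j) ∨ (a = j ∧ b = i) then C a b - 1 else C a b
  | Sum.inl a, Sum.inr _ =>
      if a = i then C i i + C i j - 1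
      else if a = j then C j j + C i j - 1
      else C i a + C j a
  | Sum.inr _, Sum.inl b =>
      if b = i then C i i + C i j - 1
      else if b = j then C j j + C i j - 1
      else C i b + C j b
  | Sum.inr _, Sum.inr _ => C i i + C j j + 2 * C i j - 1

/-- The dimension vector `d^e` on the extended index set: `d` away from `i, j`,
`d_i - e` at `i`, `d_j - e` at `j`, and `e` at the new index. -/
def dvec {m : ℕ} (d : Fin m → ℕ) (i j : Fin m) (e : ℕ) : (Fin m ⊕ Unit) → ℕ
  | Sum.inl a => if a = i then d i - e else if a = j then d j - e else d a
  | Sum.inr _ => e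

/-- Unlinking changes the quadratic form by `e² - 2 d_i d_j` along the vectors `d^e`. -/
theorem qform_unlinkQuiver_dvec {m : ℕ} (C : Fin m → Fin m → ℤ) (hsym : ∀ a b, C a b = C b a)
    {i j : Fin m} (hij : i ≠ j) (d : Fin m → ℕ) {e : ℕ} (hi : e ≤ d i) (hj : e ≤ d j) :
    qform (unlinkQuiver C i j) (dvec d i j e) = qform C d + ((e : ℤ) ^ 2 - 2 * d i * d j) := by
  obtain ⟨δ, hδ⟩ : ∃ δ : Fin m → Fin m → ℤ, ∀ x a, δ x a = if a = x then 1 else 0 :=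
    ⟨_, fun _ _ => rfl⟩
  have sum_left (x : Fin m) (f : Fin m → ℤ) : ∑ a, δ x a * f a = f x := by simp [hδ]
  obtain ⟨x, hx⟩ : ∃ x : Fin m → ℤ, ∀ a, x a = d a - e * (δ i a + δ j a) := ⟨_, fun _ => rfl⟩
  have hd (a : Fin m) : (d a : ℤ) = x a + e * (δ i a + δ j a) := by rw [hx]; ring
  have hv (a : Fin m) : ((dvec d i j e (Sum.inl a) : ℕ) : ℤ) = x a := by
    by_cases h : a = i
    · subst h; simp [dvec, hx, hδ, hij, Nat.cast_sub hi]
    · by_cases h' : a = j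
      · subst h'; simp [dvec, hx, hδ, h, Nat.cast_sub hj]
      · simp [dvec, hx, hδ, h, h']
  have hU (a b : Fin m) : unlinkQuiver C i j (Sum.inl a) (Sum.inl b) =
      C a b - δ i a * δ j b - δ j a * δ i b := by
    simp only [unlinkQuiver, hδ]
    split_ifs <;> grind
  have hN (a : Fin m) : unlinkQuiver C i j (Sum.inl a) (Sum.inr ()) =
      C i a + C j a - δ i a - δ j a := by
    simp only [unlinkQuiver, hδ]
    split_ifs <;> grind
  have hN' (a : Fin m) : unlinkQuiver C i j (Sum.inr ()) (Sum.inl a) =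
      C i a + C j a - δ i a - δ j a := by
    simp only [unlinkQuiver, hδ]
    split_ifs <;> grind
  have hxi : x i = d i - e := by simp [hx, hδ, hij]
  have hxj : x j = d j - e := by simp [hx, hδ, hij.symm]
  have inner_left (a : Fin m) : ∑ b, x a * (C a b - δ i a * δ j b - δ j a * δ i b) * x b =
      x a * ∑ b, C a b * x b - δ i a * (x a * x j) - δ j a * (x a * x i) := by
    rw [← sum_left j x, ← sum_left i x]
    simp only [Finset.mul_sum, ← Finset.sum_sub_distrib]
    exact Finset.sum_congr rfl fun b _ => by ring
  have inner_right (a : Fin m) : ∑ b, (x a + e * (δ i a + δ j a)) * C a b *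
      (x b + e * (δ i b + δ j b)) =
      x a * ∑ b, C a b * x b + e * (x a * (C i a + C j a)) +
        (δ i a * (e * (∑ b, C a b * x b + e * (C a i + C a j))) +
        δ j a * (e * (∑ b, C a b * x b + e * (C a i + C a j)))) := by
    rw [hsym i a, hsym j a, ← sum_left j (C a), ← sum_left i (C a)]
    simp only [Finset.mul_sum, ← Finset.sum_add_distrib]
    exact Finset.sum_congr rfl fun b _ => by ring
  have cross : ∑ a, x a * (C i a + C j a - δ i a - δ j a) * e =
      e * (∑ a, x a * (C i a + C j a) - x i - x j) := by
    rw [← sum_left j x, ← sum_left i x]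
    simp only [Finset.mul_sum, ← Finset.sum_sub_distrib]
    exact Finset.sum_congr rfl fun b _ => by ring
  have cross' : ∑ a, e * (C i a + C j a - δ i a - δ j a) * x a =
      e * (∑ a, x a * (C i a + C j a) - x i - x j) := by
    rw [← cross]
    exact Finset.sum_congr rfl fun b _ => by ring
  have split : ∑ a, x a * (C i a + C j a) = ∑ a, C i a * x a + ∑ a, C j a * x a := by
    rw [← Finset.sum_add_distrib]
    exact Finset.sum_congr rfl fun b _ => by ring
  have hνν : unlinkQuiver C i j (Sum.inr ()) (Sum.inr ()) =
    C i i + C j j + 2 * C i j - 1 := rfl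
  have hν : dvec d i j e (Sum.inr ()) = e := rfl
  have hL : qform (unlinkQuiver C i j) (dvec d i j e) =
      ∑ a, x a * ∑ b, C a b * x b - 2 * (x i * x j) +
      2 * (e * (∑ a, x a * (C i a + C j a) - x i - x j)) +
      e * (C i i + C j j + 2 * C i j - 1) * e := by
    simp only [qform, Fintype.sum_sum_type, Finset.univ_unique, Finset.sum_singleton,
      PUnit.default_eq_unit, hv, hU, hN, hN', hνν, hν, Finset.sum_add_distrib, inner_left,
      Finset.sum_sub_distrib, sum_left, cross, cross']
    ring
  have hR : qform C d = ∑ a, x a * ∑ b, C a b * x b + e * ∑ a, x a * (C i a + C j a) +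
      (e * (∑ b, C i b * x b + e * (C i i + C i j)) +
      e * (∑ b, C j b * x b + e * (C j i + C j j))) := by
    simp only [qform, hd, inner_right, Finset.sum_add_distrib, sum_left, ← Finset.mul_sum]
  rw [hL, hR, split, hxi, hxj, hsym j i]
  ring

theorem one_sub_qvar_pow_ne_zero {n : ℕ} (hn : n ≠ 0) : 1 - qvar ^ n ≠ 0 := by
  intro h
  have h1 : algebraMap (Polynomial ℚ) (RatFunc ℚ) (Polynomial.X ^ n) =
      algebraMap (Polynomial ℚ) (RatFunc ℚ) 1 := by
    simpa [qvar, RatFunc.algebraMap_X] using (sub_eq_zero.mp h).symm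
  have h2 := congrArg Polynomial.natDegree (RatFunc.algebraMap_injective ℚ h1)
  simp at h2
  exact hn h2

theorem qPoch_ne_zero (n : ℕ) : qPoch n ≠ 0 :=
  Finset.prod_ne_zero_iff.mpr fun _ _ => one_sub_qvar_pow_ne_zero (by omega)

theorem qPoch_succ (n : ℕ) : qPoch (n + 1) = qPoch n * (1 - qvar ^ (2 * n + 2)) :=
  Finset.prod_range_succ _ _

/-- The falling q-factorial `∏_{t<e} (1 - q^{2(n-t)})`, which vanishes for `e > n`. -/
noncomputable def qDescFactorial (n e : ℕ) : RatFunc ℚ :=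
  ∏ t ∈ Finset.range e, (1 - qvar ^ (2 * (n - t)))

theorem qDescFactorial_zero_succ (e : ℕ) : qDescFactorial 0 (e + 1) = 0 := by
  simp [qDescFactorial]

theorem qDescFactorial_succ_succ (n e : ℕ) :
    qDescFactorial (n + 1) (e + 1) = (1 - qvar ^ (2 * n + 2)) * qDescFactorial n e := by
  rw [qDescFactorial, Finset.prod_range_succ', mul_comm]
  simp only [Nat.add_sub_add_right, Nat.sub_zero, mul_add, mul_one, qDescFactorial]

theorem qDescFactorial_mul_qPoch {n e : ℕ} (h : e ≤ n) :
    qDescFactorial n e * qPoch (n - e) = qPoch n := by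
  induction e generalizing n with
  | zero => simp [qDescFactorial]
  | succ e ih =>
    obtain ⟨n, rfl⟩ := Nat.exists_eq_succ_of_ne_zero (by omega : n ≠ 0)
    rw [Nat.succ_eq_add_one, qDescFactorial_succ_succ, Nat.add_sub_add_right, mul_assoc,
      ih (by omega), qPoch_succ, mul_comm]

theorem qDescFactorial_eq_zero {n e : ℕ} (h : n < e) : qDescFactorial n e = 0 :=
  Finset.prod_eq_zero (Finset.mem_range.mpr h) (by simp)

/-- The terminating alternating sum behind the q-Chu–Vandermonde identity. -/
noncomputable def qVandermondeSum (n k : ℕ) : RatFunc ℚ :=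
  ∑ e ∈ Finset.range (k + 1),
    (-1) ^ e * qvar ^ (e * (e - 1)) * qDescFactorial n e / (qPoch e * qPoch (k - e))

theorem one_sub_mul_qVandermondeSum_succ (n k : ℕ) :
    (1 - qvar ^ (2 * k + 2)) * qVandermondeSum (n + 1) (k + 1) =
      qVandermondeSum (n + 1) k -
        qvar ^ (2 * k) * (1 - qvar ^ (2 * n + 2)) * qVandermondeSum n k := by
  set t : ℕ → RatFunc ℚ := fun e => (-1) ^ e * qvar ^ (e * (e - 1)) *
    qDescFactorial (n + 1) e / (qPoch e * qPoch (k + 1 - e)) with ht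
  have hsplit : (1 - qvar ^ (2 * k + 2)) * qVandermondeSum (n + 1) (k + 1) =
      ∑ e ∈ Finset.range (k + 1 + 1), t e * (1 - qvar ^ (2 * (k + 1 - e))) +
      ∑ e ∈ Finset.range (k + 1 + 1),
        t e * (qvar ^ (2 * (k + 1 - e)) * (1 - qvar ^ (2 * e))) := by
    rw [qVandermondeSum, Finset.mul_sum, ← Finset.sum_add_distrib]
    refine Finset.sum_congr rfl fun e he => ?_
    have : 2 * k + 2 = 2 * (k + 1 - e) + 2 * e := by
      have := Finset.mem_range.mp he
      omega
    rw [this, pow_add]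
    simp only [ht]
    ring
  rw [hsplit, Finset.sum_range_succ, Finset.sum_range_succ' _ (k + 1),
    sub_eq_add_neg (qVandermondeSum (n + 1) k)]
  simp only [Nat.sub_self, mul_zero, pow_zero, sub_self, add_zero]
  congr 1
  · refine Finset.sum_congr rfl fun e he => ?_
    have he' := Finset.mem_range.mp he
    have h1 : k + 1 - e = (k - e) + 1 := by omega
    have h2 := qPoch_ne_zero e
    have h3 := qPoch_ne_zero (k - e)
    have h4 := one_sub_qvar_pow_ne_zero (n := 2 * (k - e) + 2) (by omega)
    simp only [ht, h1, qPoch_succ, mul_add, mul_one]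
    field_simp
  · rw [qVandermondeSum, Finset.mul_sum, ← Finset.sum_neg_distrib]
    refine Finset.sum_congr rfl fun e he => ?_
    have he' := Finset.mem_range.mp he
    have h2 := qPoch_ne_zero e
    have h3 := qPoch_ne_zero (k - e)
    have h4 := one_sub_qvar_pow_ne_zero (n := 2 * e + 2) (by omega)
    have hexp : qvar ^ ((e + 1) * (e + 1 - 1)) * qvar ^ (2 * (k - e)) =
        qvar ^ (e * (e - 1)) * qvar ^ (2 * k) := by
      rw [← pow_add, ← pow_add]
      congr 1
      obtain ⟨f, rfl⟩ := Nat.exists_eq_add_of_le (Nat.lt_succ_iff.mp he')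
      cases e with
      | zero => simp
      | succ e => simp only [Nat.add_sub_cancel, Nat.add_sub_cancel_left]; ring
    simp only [ht, Nat.add_sub_add_right, qPoch_succ, qDescFactorial_succ_succ, mul_add, mul_one]
    field_simp
    linear_combination (-1) ^ (e + 1) * qDescFactorial n e * (1 - qvar ^ (2 * n + 2)) * hexp

theorem qVandermondeSum_eq (n k : ℕ) :
    qVandermondeSum n k = qvar ^ (2 * n * k) / qPoch k := by
  induction k generalizing n with
  | zero => simp [qVandermondeSum, qDescFactorial, qPoch]
  | succ k ih =>
    cases n with
    | zero =>
      rw [qVandermondeSum, Finset.sum_range_succ']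
      simp only [qDescFactorial_zero_succ]
      simp [qDescFactorial, qPoch]
    | succ n =>
      have h := one_sub_mul_qVandermondeSum_succ n k
      have h1 := one_sub_qvar_pow_ne_zero (n := 2 * k + 2) (by omega)
      have h2 := qPoch_ne_zero k
      rw [ih, ih] at h
      rw [← mul_right_inj' h1, h, qPoch_succ]
      field_simp
      ring

/-- A q-Chu–Vandermonde identity in `ℚ(q)`. -/
theorem sum_range_min_qPoch (n k : ℕ) :
    ∑ e ∈ Finset.range (min n k + 1),
      (-1) ^ e * qvar ^ (e * (e - 1)) / (qPoch e * (qPoch (n - e) * qPoch (k - e))) =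
      qvar ^ (2 * n * k) / (qPoch n * qPoch k) := by
  have hn := qPoch_ne_zero n
  rw [mul_comm (qPoch n), ← div_div, ← qVandermondeSum_eq, qVandermondeSum, Finset.sum_div]
  refine Finset.sum_subset_zero_on_sdiff (Finset.range_mono (by omega)) (fun e he => ?_)
    fun e he => ?_
  · simp only [Finset.mem_sdiff, Finset.mem_range] at he
    rw [qDescFactorial_eq_zero (by omega)]
    simp
  · have h := qDescFactorial_mul_qPoch (n := n) (e := e) (by
      have := Finset.mem_range.mp he
      omega)
    have h1 := qPoch_ne_zero e
    have h2 := qPoch_ne_zero (n - e)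
    have h3 := qPoch_ne_zero (k - e)
    field_simp
    linear_combination -qvar ^ (e * (e - 1)) * h

theorem neg_qvar_zpow_mul (A : ℤ) (n k e : ℕ) :
    (-qvar) ^ (A + ((e : ℤ) ^ 2 - 2 * n * k)) * qvar⁻¹ ^ e =
      (-qvar) ^ A / qvar ^ (2 * n * k) * ((-1) ^ e * qvar ^ (e * (e - 1))) := by
  have hq : qvar ≠ 0 := RatFunc.X_ne_zero
  have hsq : ((-1 : RatFunc ℚ)) ^ (e ^ 2) = (-1) ^ e := by
    rcases Nat.even_or_odd e with h | h
    · rw [h.neg_one_pow, (h.pow_of_ne_zero two_ne_zero).neg_one_pow]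
    · rw [h.neg_one_pow, h.pow.neg_one_pow]
  have hexp : qvar ^ (e ^ 2) = qvar ^ (e * (e - 1)) * qvar ^ e := by
    rw [← pow_add]
    congr 1
    cases e with
    | zero => rfl
    | succ e => simp only [Nat.add_sub_cancel]; ring
  have heven : (-qvar) ^ (2 * n * k) = qvar ^ (2 * n * k) := by
    rw [mul_assoc, pow_mul, pow_mul qvar, neg_sq]
  have hcast : A + ((e : ℤ) ^ 2 - 2 * n * k) = A + ((e ^ 2 : ℕ) : ℤ) - ((2 * n * k : ℕ) : ℤ) := by
    push_cast
    ring
  rw [hcast, zpow_sub₀ (neg_ne_zero.mpr hq), zpow_add₀ (neg_ne_zero.mpr hq), zpow_natCast,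
    zpow_natCast, heven, neg_pow qvar (e ^ 2), hsq, hexp, inv_pow]
  field_simp

theorem prod_eq_mul_mul_prod_erase {m : ℕ} {M : Type*} [CommMonoid M] {i j : Fin m} (hij : i ≠ j)
    (f : Fin m → M) :
    ∏ a, f a = f i * f j * ∏ a ∈ (Finset.univ.erase i).erase j, f a := by
  rw [mul_assoc, Finset.mul_prod_erase _ f (by simp [hij.symm]),
    Finset.mul_prod_erase _ f (Finset.mem_univ i)]

theorem prod_qPoch_dvec {m : ℕ} {i j : Fin m} (hij : i ≠ j) (d : Fin m → ℕ) (e : ℕ) :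
    ∏ a, qPoch (dvec d i j e (Sum.inl a)) = qPoch (d i - e) * qPoch (d j - e) *
      ∏ a ∈ (Finset.univ.erase i).erase j, qPoch (d a) := by
  rw [prod_eq_mul_mul_prod_erase hij]
  congr 1
  · simp [dvec, hij.symm]
  · refine Finset.prod_congr rfl fun a ha => ?_
    simp only [Finset.mem_erase] at ha
    simp [dvec, ha.1, ha.2.1]

/-- Unlinking preserves the motivic generating series: for a symmetric `m×m` integer
matrix `C`, distinct indices `i ≠ j`, and every dimension vector `d ∈ ℕ^m`, the
coefficient identity
`∑_{e=0}^{min(d_i,d_j)} (-q)^{(d^e)ᵀ (U(ij)C) (d^e)} q^{-e} / ((q²;q²)_e ∏_a (q²;q²)_{(d^e)_a})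
  = (-q)^{dᵀCd} / ∏_a (q²;q²)_{d_a}`
holds in `ℚ(q)` (the factor `q^{-e}` coming from the specialization `x_ν = q⁻¹ x_i x_j`). -/
theorem unlinking_preserves_motivic_generating_series
    {m : ℕ} (C : Fin m → Fin m → ℤ) (hsym : ∀ a b, C a b = C b a)
    (i j : Fin m) (hij : i ≠ j) (d : Fin m → ℕ) :
    ∑ e ∈ Finset.range (min (d i) (d j) + 1),
      (-qvar) ^ qform (unlinkQuiver C i j) (dvec d i j e) * qvar⁻¹ ^ e /
        (qPoch e * ∏ a : Fin m, qPoch (dvec d i j e (Sum.inl a))) =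
    (-qvar) ^ qform C d / ∏ a : Fin m, qPoch (d a) := by
  have hq : qvar ≠ 0 := RatFunc.X_ne_zero
  have hterm (e : ℕ) (he : e ∈ Finset.range (min (d i) (d j) + 1)) :
      (-qvar) ^ qform (unlinkQuiver C i j) (dvec d i j e) * qvar⁻¹ ^ e /
        (qPoch e * ∏ a : Fin m, qPoch (dvec d i j e (Sum.inl a))) =
      (-qvar) ^ qform C d / qvar ^ (2 * d i * d j) /
          (∏ a ∈ (Finset.univ.erase i).erase j, qPoch (d a)) *
        ((-1) ^ e * qvar ^ (e * (e - 1)) /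
          (qPoch e * (qPoch (d i - e) * qPoch (d j - e)))) := by
    have he' := Finset.mem_range.mp he
    rw [qform_unlinkQuiver_dvec C hsym hij d (by omega) (by omega), neg_qvar_zpow_mul,
      prod_qPoch_dvec hij, div_mul_div_comm]
    congr 1
    ring
  rw [Finset.sum_congr rfl hterm, ← Finset.mul_sum, sum_range_min_qPoch,
    prod_eq_mul_mul_prod_erase hij]
  field_simp
end

section
/- (Splitting by linking.) Let C be a symmetric m×m integer matrix, designate its last n indices as split nodes and the remaining m−n as spectators, fix integers k, l and an integer shift h_s for each spectator s. Let C⁺ be the symmetric (m+1)×(m+1) matrix agreeing with C on the first m indices and having an extra index ι with C⁺(ι,s) = h_s for each spectator s, C⁺(ι,i) = k for each split node i, and C⁺(ι,ι) = l − 2k. Perform the n linkings L(i,ι), one for each split node i (each linking taken with the original extra index ι, and the new index created by the linking at node i denoted i′), in any chosen order. Then the resulting symmetric (m+n+1)×(m+n+1) matrix is described as follows: (1) its restriction to the indices other than ι equals the (k,l)-splitting C^σ of C, where σ is the permutation of the split nodes assigning larger values to nodes linked earlier (so that for split nodes i < j one has σ(i) > σ(j) exactly when the linking at i was performed before the linking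 at j); and (2) the extra row of ι is given by: diagonal entry l − 2k, entry h_s at each spectator s, entry k + 1 at each split node i, and entry l − k at each copy i′. -/
/-- The linking `L(i,j)` of a quiver matrix (encoded as a function `ℕ → ℕ → ℤ`),
with the new index placed at the fresh position `ν`. -/
def linkAt (ν i j : ℕ) (C : ℕ → ℕ → ℤ) : ℕ → ℕ → ℤ := fun a b =>
  if a = ν then
    if b = ν then C i i + C j j + 2 * C i j
    else if b = i then C i i + C i j
    else if b = j then C j j + C i j
    else C i b + C j b
  else if b = ν then
    if a = i then C i i + C i j
    else if a = j then C j j + C i j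
    else C i a + C j a
  else if (a = i ∧ b = j) ∨ (a = j ∧ b = i) then C a b + 1
  else C a b

/-- Perform the first `t` of the `n` linkings `L(i,ι)` of the split nodes
`s, s+1, …, s+n-1` with the extra node `ι = s+n`, in the order prescribed by
`ord : Equiv.Perm (Fin n)` (at time `t` the node `s + ord t` is linked, the new
index being appended at position `s + n + 1 + t`). -/
def iterLink (s n : ℕ) (ord : Equiv.Perm (Fin n)) (C0 : ℕ → ℕ → ℤ) : ℕ → ℕ → ℕ → ℤ
  | 0 => C0
  | t + 1 =>
      if h : t < n then
        linkAt (s + n + 1 + t) (s + ((ord ⟨t, h⟩ : Fin n) : ℕ)) (s + n)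
          (iterLink s n ord C0 t)
      else iterLink s n ord C0 t

/-- The matrix obtained after the first `t` linkings of the nodes `f 0, f 1, …` with `s + n`. -/
structure IsPartialSplitting (s n : ℕ) (C : ℕ → ℕ → ℤ) (hsh : ℕ → ℤ) (k l : ℤ) (f : ℕ → ℕ)
    (t : ℕ) (F : ℕ → ℕ → ℤ) : Prop where
  old : ∀ a b, a < s + n → b < s + n → F a b = C a b
  extra_extra : F (s + n) (s + n) = l - 2 * k
  extra_spectator : ∀ a, a < s → F (s + n) a = hsh a
  extra_split : ∀ p, p < n → F (s + n) (f p) = if p < t then k + 1 else k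
  extra_copy : ∀ p, p < t → F (s + n) (s + n + 1 + p) = l - k
  spectator_copy : ∀ a p, a < s → p < t → F a (s + n + 1 + p) = C a (f p) + hsh a
  split_copy : ∀ q p, q < n → p < t →
    F (f q) (s + n + 1 + p) = C (f q) (f p) + if p ≤ q then k else k + 1
  copy_copy : ∀ p q, p < t → q < t →
    F (s + n + 1 + p) (s + n + 1 + q) = C (f p) (f q) + l
  symm : ∀ a b, a < s + n + 1 + t → b < s + n + 1 + t → F a b = F b a

theorem IsPartialSplitting.linkAt {s n : ℕ} {C : ℕ → ℕ → ℤ} {hsh : ℕ → ℤ} {k l : ℤ}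
    {f : ℕ → ℕ} {t : ℕ} {F : ℕ → ℕ → ℤ}
    (hsym : ∀ a b, a < s + n → b < s + n → C a b = C b a)
    (hf : ∀ p, p < n → s ≤ f p ∧ f p < s + n)
    (hinj : ∀ p q, p < n → q < n → f p = f q → p = q) (ht : t < n)
    (hF : IsPartialSplitting s n C hsh k l f t F) :
    IsPartialSplitting s n C hsh k l f (t + 1) (linkAt (s + n + 1 + t) (f t) (s + n) F) := by
  obtain ⟨h1, h2, h3, h4, h5, h6, h7, h8, h9⟩ := hF
  have hft := hf t ht
  have h4t := h4 t ht
  have h4s := h9 (s + n) (f t) (by omega) (by omega)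
  have h1t := h1 (f t) (f t) hft.2 hft.2
  refine ⟨?_, ?_, ?_, ?_, ?_, ?_, ?_, ?_, ?_⟩
  · intro a b ha hb
    grind [_root_.linkAt]
  · grind [_root_.linkAt]
  · intro a ha
    grind [_root_.linkAt]
  · intro p hp
    have := hf p hp
    have := hinj p t hp ht
    have := h4 p hp
    grind [_root_.linkAt]
  · intro p hp
    have := h5 p
    grind [_root_.linkAt]
  · intro a p ha hp
    have := h6 a p ha
    have := h3 a ha
    have := h1 a (f t) (by omega) hft.2
    have := h1 (f t) a hft.2 (by omega)
    have := hsym a (f t) (by omega) hft.2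
    grind [_root_.linkAt]
  · intro q p hq hp
    have := hf q hq
    have := hinj q t hq ht
    have := h4 q hq
    have := h7 q p hq
    have := h1 (f t) (f q) hft.2 (by omega)
    have := hsym (f q) (f t) (by omega) hft.2
    grind [_root_.linkAt]
  · intro p q hp hq
    have := h8 p q
    have := h7 t p ht
    have := h7 t q ht
    have := h5 p
    have := h5 q
    have := hf p (by omega)
    have := hsym (f p) (f t) (by omega) hft.2
    grind [_root_.linkAt]
  · intro a b ha hb
    have := h9 a b
    grind [_root_.linkAt]

theorem isPartialSplitting_iterLink {s n : ℕ} {C : ℕ → ℕ → ℤ} {hsh : ℕ → ℤ} {k l : ℤ}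
    {f : ℕ → ℕ} {ord : Equiv.Perm (Fin n)} {C0 : ℕ → ℕ → ℤ}
    (hsym : ∀ a b, a < s + n → b < s + n → C a b = C b a)
    (hf : ∀ p : Fin n, f p = s + ord p)
    (h0 : IsPartialSplitting s n C hsh k l f 0 C0) :
    ∀ t, t ≤ n → IsPartialSplitting s n C hsh k l f t (iterLink s n ord C0 t)
  | 0, _ => h0
  | t + 1, ht => by
    have hlt : t < n := ht
    rw [iterLink, dif_pos hlt, ← hf ⟨t, hlt⟩]
    refine (isPartialSplitting_iterLink hsym hf h0 t hlt.le).linkAt hsym ?_ ?_ hlt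
    · intro p hp
      have := hf ⟨p, hp⟩
      grind
    · intro p q hp hq h
      have hp' := hf ⟨p, hp⟩
      have hq' := hf ⟨q, hq⟩
      have : ord ⟨p, hp⟩ = ord ⟨q, hq⟩ := Fin.ext (by grind)
      simpa using ord.injective this

/-- **Splitting by linking.** Let `C` be a symmetric `(s+n)×(s+n)` integer matrix whose
last `n` indices `s,…,s+n-1` are the split nodes and whose first `s` indices are
spectators with shifts `hsh`, and fix integers `k, l`.  Augment `C` by an extra index
`ι = s+n` with entries `hsh` at spectators, `k` at split nodes and diagonal `l - 2k`.
Performing the `n` linkings `L(i,ι)` in the order prescribed by `ord`, the resulting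
matrix restricted away from `ι` is the `(k,l)`-splitting `C^σ` of `C` (the copy of the
split node `i` sitting at `cp i = s+n+1+ord⁻¹(i)`, and `σ` assigning larger values to
nodes linked earlier, so that `σ(i) < σ(j) ↔ ord⁻¹(j) < ord⁻¹(i)`), while the extra
row of `ι` has diagonal `l - 2k`, entries `hsh` at spectators, `k+1` at split nodes and
`l - k` at the copies. -/
theorem splitting_by_linking
    (s n : ℕ) (C : ℕ → ℕ → ℤ)
    (hsym : ∀ a b, a < s + n → b < s + n → C a b = C b a)
    (hsh : ℕ → ℤ) (k l : ℤ) (ord : Equiv.Perm (Fin n)) :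
    let ι := s + n
    let Cplus : ℕ → ℕ → ℤ := fun a b =>
      if a = ι then (if b = ι then l - 2 * k else if b < s then hsh b else k)
      else if b = ι then (if a < s then hsh a else k)
      else C a b
    let F := iterLink s n ord Cplus n
    let cp : Fin n → ℕ := fun i => s + n + 1 + ((ord.symm i : Fin n) : ℕ)
    -- (1) the restriction away from ι is the (k,l)-splitting C^σ of C:
    (∀ a b, a < s → b < s → F a b = C a b) ∧
    (∀ a, a < s → ∀ i : Fin n,
      F a (s + (i : ℕ)) = C a (s + (i : ℕ)) ∧
      F (s + (i : ℕ)) a = C (s + (i : ℕ)) a ∧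
      F a (cp i) = C a (s + (i : ℕ)) + hsh a ∧
      F (cp i) a = C a (s + (i : ℕ)) + hsh a) ∧
    (∀ i : Fin n,
      F (s + (i : ℕ)) (s + (i : ℕ)) = C (s + (i : ℕ)) (s + (i : ℕ)) ∧
      F (s + (i : ℕ)) (cp i) = C (s + (i : ℕ)) (s + (i : ℕ)) + k ∧
      F (cp i) (s + (i : ℕ)) = C (s + (i : ℕ)) (s + (i : ℕ)) + k ∧
      F (cp i) (cp i) = C (s + (i : ℕ)) (s + (i : ℕ)) + l) ∧
    (∀ i j : Fin n, i ≠ j →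
      F (s + (i : ℕ)) (s + (j : ℕ)) = C (s + (i : ℕ)) (s + (j : ℕ)) ∧
      F (cp i) (cp j) = C (s + (i : ℕ)) (s + (j : ℕ)) + l ∧
      F (s + (i : ℕ)) (cp j) =
        C (s + (i : ℕ)) (s + (j : ℕ)) +
          (if ((ord.symm j : Fin n) : ℕ) < ((ord.symm i : Fin n) : ℕ) then k else k + 1) ∧
      F (cp j) (s + (i : ℕ)) =
        C (s + (i : ℕ)) (s + (j : ℕ)) +
          (if ((ord.symm j : Fin n) : ℕ) < ((ord.symm i : Fin n) : ℕ) then k else k + 1)) ∧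
    -- (2) the extra row of ι:
    F ι ι = l - 2 * k ∧
    (∀ a, a < s → F ι a = hsh a ∧ F a ι = hsh a) ∧
    (∀ i : Fin n, F ι (s + (i : ℕ)) = k + 1 ∧ F (s + (i : ℕ)) ι = k + 1) ∧
    (∀ i : Fin n, F ι (cp i) = l - k ∧ F (cp i) ι = l - k) := by
  intro ι Cplus F cp
  let f : ℕ → ℕ := fun p => if h : p < n then s + ord ⟨p, h⟩ else 0
  have hf : ∀ p : Fin n, f p = s + ord p := fun p => by simp [f]
  have hfs : ∀ i : Fin n, f (ord.symm i) = s + i := fun i => by simp [hf]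
  have h0 : IsPartialSplitting s n C hsh k l f 0 Cplus := by
    have hf' : ∀ p, p < n → s ≤ f p ∧ f p < s + n := fun p hp => by
      have := hf ⟨p, hp⟩
      grind
    constructor <;> grind
  obtain ⟨h1, h2, h3, h4, h5, h6, h7, h8, h9⟩ :=
    isPartialSplitting_iterLink (ord := ord) hsym hf h0 n le_rfl
  change ∀ a b, _ → _ → F a b = F b a at h9
  have hcp : ∀ i, cp i < s + n + 1 + n := fun i => by grind
  have hnode : ∀ i : Fin n, s + (i : ℕ) < s + n := fun i => by omega
  have hec : ∀ i, F ι (cp i) = l - k := fun i => h5 _ (ord.symm i).2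
  have hes : ∀ i : Fin n, F ι (s + i) = k + 1 := fun i => by
    have := h4 _ (ord.symm i).2
    rwa [hfs, if_pos (ord.symm i).2] at this
  have hac : ∀ a, a < s → ∀ i, F a (cp i) = C a (s + i) + hsh a := fun a ha i => by
    have := h6 a _ ha (ord.symm i).2
    rwa [hfs] at this
  have hsc : ∀ i j : Fin n, F (s + i) (cp j) = C (s + i) (s + j) +
      if (ord.symm j : ℕ) ≤ ord.symm i then k else k + 1 := fun i j => by
    have := h7 _ _ (ord.symm i).2 (ord.symm j).2
    rwa [hfs, hfs] at this
  have hcc : ∀ i j : Fin n, F (cp i) (cp j) = C (s + i) (s + j) + l := fun i j => by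
    have := h8 _ _ (ord.symm i).2 (ord.symm j).2
    rwa [hfs, hfs] at this
  have hsc' : ∀ i j : Fin n, F (cp j) (s + i) = F (s + i) (cp j) := fun i j =>
    h9 _ _ (hcp j) (by omega)
  refine ⟨fun a b ha hb => h1 a b (by omega) (by omega), fun a ha i => ⟨h1 _ _ (by omega) (hnode i),
    h1 _ _ (hnode i) (by omega), hac a ha i, ?_⟩, fun i => ⟨h1 _ _ (hnode i) (hnode i), ?_, ?_,
    hcc i i⟩, fun i j hij => ?_, h2, fun a ha => ⟨h3 a ha, ?_⟩, fun i => ⟨hes i, ?_⟩,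
    fun i => ⟨hec i, ?_⟩⟩
  · rw [h9 _ _ (hcp i) (by omega), hac a ha i]
  · simp [hsc]
  · simp [hsc', hsc]
  · have hne : (ord.symm j : ℕ) ≠ ord.symm i := fun h =>
      hij (ord.symm.injective (Fin.ext h)).symm
    rw [hsc', hsc]
    simp only [le_iff_lt_or_eq, hne, or_false, and_true]
    exact ⟨h1 _ _ (hnode i) (hnode j), hcc i j⟩
  · rw [h9 _ _ (by omega) (by omega)]
    exact h3 a ha
  · rw [h9 _ _ (by omega) (by omega)]
    exact hes i
  · rw [h9 _ _ (hcp i) (by omega)]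
    exact hec i
end

section
/- (Splitting by unlinking.) Let C be a symmetric m×m integer matrix, designate its last n indices as split nodes and the remaining m−n as spectators, fix integers k, l and an integer shift h_s for each spectator s. Let C⁺ be the symmetric (m+1)×(m+1) matrix agreeing with C on the first m indices and having an extra index ι with C⁺(ι,s) = h_s for each spectator s, C⁺(ι,i) = k + 1 for each split node i, and C⁺(ι,ι) = l − 2k − 1. Perform the n unlinkings U(i,ι), one for each split node i (each unlinking taken with the original extra index ι, and the new index created by the unlinking at node i denoted i′), in any chosen order. Then the resulting symmetric (m+n+1)×(m+n+1) matrix is described as follows: (1) its restriction to the indices other than ι equals the (k,l)-splitting C^σ of C, where σ is the permutation of the split nodes assigning smaller values to nodes unlinked earlier (so that for split nodes i < j one has σ(i) < σ(j) exactly when the unlinking at i was performed before the unlinking at j); and (2) the extra row of ι is given by: diagonal entry l − 2k − 1, entry h_s at each spectator s, entry k at each split node i, and entry l − k − 1 at each copy i′. -/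
/-- The unlinking `U(i,j)` of a quiver matrix (encoded as a function `ℕ → ℕ → ℤ`),
with the new index placed at the fresh position `ν`. -/
def unlinkAt (ν i j : ℕ) (C : ℕ → ℕ → ℤ) : ℕ → ℕ → ℤ := fun a b =>
  if a = ν then
    if b = ν then C i i + C j j + 2 * C i j - 1
    else if b = i then C i i + C i j - 1
    else if b = j then C j j + C i j - 1
    else C i b + C j b
  else if b = ν then
    if a = i then C i i + C i j - 1
    else if a = j then C j j + C i j - 1
    else C i a + C j a
  else if (a = i ∧ b = j) ∨ (a = j ∧ b = i) then C a b - 1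
  else C a b

/-- Perform the first `t` of the `n` unlinkings `U(i,ι)` of the split nodes
`s, s+1, …, s+n-1` with the extra node `ι = s+n`, in the order prescribed by
`ord : Equiv.Perm (Fin n)` (at time `t` the node `s + ord t` is unlinked, the new
index being appended at position `s + n + 1 + t`). -/
def iterUnlink (s n : ℕ) (ord : Equiv.Perm (Fin n)) (C0 : ℕ → ℕ → ℤ) : ℕ → ℕ → ℕ → ℤ
  | 0 => C0
  | t + 1 =>
      if h : t < n then
        unlinkAt (s + n + 1 + t) (s + ((ord ⟨t, h⟩ : Fin n) : ℕ)) (s + n)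
          (iterUnlink s n ord C0 t)
      else iterUnlink s n ord C0 t

/-- The shape of the matrix after the nodes `p 0, …, p (t-1)` have been unlinked from
`s + n`, the copy of `p u` sitting at `s + n + 1 + u`. -/
structure IsPartialSplitting_s9 (s n : ℕ) (C : ℕ → ℕ → ℤ) (hsh : ℕ → ℤ) (k l : ℤ)
    (p : Fin n → ℕ) (t : ℕ) (M : ℕ → ℕ → ℤ) : Prop where
  symm : ∀ a b, a < s + n + 1 + t → b < s + n + 1 + t → M a b = M b a
  old : ∀ a b, a < s + n → b < s + n → M a b = C a b
  extra_extra : M (s + n) (s + n) = l - 2 * k - 1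
  spectator_extra : ∀ a, a < s → M a (s + n) = hsh a
  split_extra : ∀ v : Fin n, M (p v) (s + n) = if (v : ℕ) < t then k else k + 1
  copy_extra : ∀ u : Fin n, (u : ℕ) < t → M (s + n + 1 + u) (s + n) = l - k - 1
  spectator_copy : ∀ u : Fin n, (u : ℕ) < t → ∀ a, a < s →
    M a (s + n + 1 + u) = C a (p u) + hsh a
  split_copy : ∀ u : Fin n, (u : ℕ) < t → ∀ v : Fin n,
    M (p v) (s + n + 1 + u) = C (p v) (p u) + if v ≤ u then k else k + 1
  copy_copy : ∀ u v : Fin n, (u : ℕ) < t → (v : ℕ) < t →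
    M (s + n + 1 + u) (s + n + 1 + v) = C (p u) (p v) + l

lemma unlinkAt_symm {N i j : ℕ} {M : ℕ → ℕ → ℤ}
    (hM : ∀ a b, a < N → b < N → M a b = M b a) (a b : ℕ) (ha : a < N + 1) (hb : b < N + 1) :
    unlinkAt N i j M a b = unlinkAt N i j M b a := by
  have := hM a b
  unfold unlinkAt
  grind

lemma unlinkAt_of_lt {N i j a b : ℕ} (M : ℕ → ℕ → ℤ) (ha : a < N) (hb : b < N)
    (h : ¬((a = i ∧ b = j) ∨ (a = j ∧ b = i))) : unlinkAt N i j M a b = M a b := by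
  unfold unlinkAt
  grind

lemma unlinkAt_new {N i j a : ℕ} (M : ℕ → ℕ → ℤ) (ha : a < N) (hi : a ≠ i) (hj : a ≠ j) :
    unlinkAt N i j M a N = M i a + M j a := by
  unfold unlinkAt
  grind

lemma IsPartialSplitting_s9.unlink {s n : ℕ} {C : ℕ → ℕ → ℤ} {hsh : ℕ → ℤ} {k l : ℤ}
    {p : Fin n → ℕ} {M : ℕ → ℕ → ℤ} {t : ℕ} (ht : t < n)
    (hsym : ∀ a b, a < s + n → b < s + n → C a b = C b a)
    (hp : Function.Injective p) (hps : ∀ u, s ≤ p u) (hpn : ∀ u, p u < s + n)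
    (h : IsPartialSplitting_s9 s n C hsh k l p t M) :
    IsPartialSplitting_s9 s n C hsh k l p (t + 1)
      (unlinkAt (s + n + 1 + t) (p ⟨t, ht⟩) (s + n) M) := by
  have hs0 := hps ⟨t, ht⟩
  have hn0 := hpn ⟨t, ht⟩
  have hlt : ∀ u : Fin n, (u : ℕ) < t + 1 → (u : ℕ) < t ∨ u = ⟨t, ht⟩ := by
    intro u hu
    rcases Nat.lt_succ_iff_lt_or_eq.1 hu with h | h
    · exact .inl h
    · exact .inr (Fin.ext h)
  have hpe : ∀ u, p u = p ⟨t, ht⟩ → u = ⟨t, ht⟩ := fun u hu => hp hu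
  have hd := h.split_extra ⟨t, ht⟩
  have hoo := h.old _ _ hn0 hn0
  have hee := h.extra_extra
  simp only [lt_irrefl, if_false] at hd
  have hsymm : ∀ a b, a < s + n + 1 + (t + 1) → b < s + n + 1 + (t + 1) →
      unlinkAt (s + n + 1 + t) (p ⟨t, ht⟩) (s + n) M a b =
        unlinkAt (s + n + 1 + t) (p ⟨t, ht⟩) (s + n) M b a := fun a b ha hb =>
    unlinkAt_symm h.symm a b (by omega) (by omega)
  refine ⟨hsymm, ?_, ?_, ?_, ?_, ?_, ?_, ?_, ?_⟩
  · intro a b ha hb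
    rw [unlinkAt_of_lt _ (by omega) (by omega) (by omega), h.old a b ha hb]
  · rw [unlinkAt_of_lt _ (by omega) (by omega) (by omega), hee]
  · intro a ha
    rw [unlinkAt_of_lt _ (by omega) (by omega) (by omega), h.spectator_extra a ha]
  · intro v
    have hv := hpn v
    by_cases hvt : v = ⟨t, ht⟩
    · subst hvt
      unfold unlinkAt
      grind
    · have hne : p v ≠ p ⟨t, ht⟩ := fun e => hvt (hpe v e)
      have : (v : ℕ) ≠ t := fun e => hvt (Fin.ext e)
      rw [unlinkAt_of_lt _ (by omega) (by omega) (by omega), h.split_extra]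
      grind
  · intro u hu
    rcases hlt u hu with hu | rfl
    · rw [unlinkAt_of_lt _ (by omega) (by omega) (by omega), h.copy_extra u hu]
    · unfold unlinkAt
      grind
  · intro u hu a ha
    rcases hlt u hu with hu | rfl
    · rw [unlinkAt_of_lt _ (by omega) (by omega) (by omega), h.spectator_copy u hu a ha]
    · rw [unlinkAt_new _ (by omega) (by omega) (by omega), h.old _ _ hn0 (by omega),
        h.symm _ a (by omega) (by omega), h.spectator_extra a ha, hsym _ _ hn0 (by omega)]
  · intro u hu v
    have hv := hpn v
    rcases hlt u hu with hu | rfl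
    · rw [unlinkAt_of_lt _ (by omega) (by omega) (by omega), h.split_copy u hu v]
    · by_cases hvt : v = ⟨t, ht⟩
      · subst hvt
        unfold unlinkAt
        grind
      · have hne : p v ≠ p ⟨t, ht⟩ := fun e => hvt (hpe v e)
        have hvt' : (v : ℕ) ≠ t := fun e => hvt (Fin.ext e)
        rw [unlinkAt_new _ (by omega) hne (by omega), h.old _ _ hn0 hv,
          h.symm _ (p v) (by omega) (by omega), h.split_extra, hsym _ _ hn0 hv]
        simp only [Fin.le_def]
        grind
  · have key : ∀ u : Fin n, (u : ℕ) < t →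
        unlinkAt (s + n + 1 + t) (p ⟨t, ht⟩) (s + n) M (s + n + 1 + u) (s + n + 1 + t) =
          C (p u) (p ⟨t, ht⟩) + l := by
      intro u hu
      rw [unlinkAt_new _ (by omega) (by omega) (by omega), h.split_copy u hu,
        h.symm _ (s + n + 1 + u) (by omega) (by omega), h.copy_extra u hu,
        hsym _ _ hn0 (hpn u), if_neg (by simp only [Fin.le_def]; omega)]
      ring
    intro u v hu hv
    rcases hlt u hu with hu | rfl <;> rcases hlt v hv with hv | rfl
    · rw [unlinkAt_of_lt _ (by omega) (by omega) (by omega), h.copy_copy u v hu hv]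
    · exact key u hu
    · rw [hsymm _ _ (by simp) (by omega), key v hv, hsym _ _ hn0 (hpn v)]
    · unfold unlinkAt
      grind

lemma isPartialSplitting_iterUnlink {s n : ℕ} {C C0 : ℕ → ℕ → ℤ} {hsh : ℕ → ℤ} {k l : ℤ}
    (ord : Equiv.Perm (Fin n))
    (hsym : ∀ a b, a < s + n → b < s + n → C a b = C b a)
    (h0 : IsPartialSplitting_s9 s n C hsh k l (fun u => s + (ord u : ℕ)) 0 C0) :
    ∀ t ≤ n, IsPartialSplitting_s9 s n C hsh k l (fun u => s + (ord u : ℕ)) t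
      (iterUnlink s n ord C0 t)
  | 0, _ => h0
  | t + 1, ht => by
    have ht' : t < n := ht
    rw [iterUnlink, dif_pos ht']
    refine (isPartialSplitting_iterUnlink ord hsym h0 t ht'.le).unlink ht' hsym ?_ ?_ ?_
    · intro u v huv
      exact ord.injective (Fin.ext (Nat.add_left_cancel huv))
    · intro u
      exact Nat.le_add_right _ _
    · intro u
      exact Nat.add_lt_add_left (ord u).isLt s

/-- **Splitting by unlinking.** Let `C` be a symmetric `(s+n)×(s+n)` integer matrix
whose last `n` indices `s,…,s+n-1` are the split nodes and whose first `s` indices are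
spectators with shifts `hsh`, and fix integers `k, l`.  Augment `C` by an extra index
`ι = s+n` with entries `hsh` at spectators, `k+1` at split nodes and diagonal
`l - 2k - 1`.  Performing the `n` unlinkings `U(i,ι)` in the order prescribed by `ord`,
the resulting matrix restricted away from `ι` is the `(k,l)`-splitting `C^σ` of `C`
(the copy of the split node `i` sitting at `cp i = s+n+1+ord⁻¹(i)`, and `σ` assigning
smaller values to nodes unlinked earlier, so that `σ(i) < σ(j) ↔ ord⁻¹(i) < ord⁻¹(j)`),
while the extra row of `ι` has diagonal `l - 2k - 1`, entries `hsh` at spectators, `k`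
at split nodes and `l - k - 1` at the copies. -/
theorem splitting_by_unlinking
    (s n : ℕ) (C : ℕ → ℕ → ℤ)
    (hsym : ∀ a b, a < s + n → b < s + n → C a b = C b a)
    (hsh : ℕ → ℤ) (k l : ℤ) (ord : Equiv.Perm (Fin n)) :
    let ι := s + n
    let Cplus : ℕ → ℕ → ℤ := fun a b =>
      if a = ι then (if b = ι then l - 2 * k - 1 else if b < s then hsh b else k + 1)
      else if b = ι then (if a < s then hsh a else k + 1)
      else C a b
    let F := iterUnlink s n ord Cplus n
    let cp : Fin n → ℕ := fun i => s + n + 1 + ((ord.symm i : Fin n) : ℕ)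
    -- (1) the restriction away from ι is the (k,l)-splitting C^σ of C:
    (∀ a b, a < s → b < s → F a b = C a b) ∧
    (∀ a, a < s → ∀ i : Fin n,
      F a (s + (i : ℕ)) = C a (s + (i : ℕ)) ∧
      F (s + (i : ℕ)) a = C (s + (i : ℕ)) a ∧
      F a (cp i) = C a (s + (i : ℕ)) + hsh a ∧
      F (cp i) a = C a (s + (i : ℕ)) + hsh a) ∧
    (∀ i : Fin n,
      F (s + (i : ℕ)) (s + (i : ℕ)) = C (s + (i : ℕ)) (s + (i : ℕ)) ∧
      F (s + (i : ℕ)) (cp i) = C (s + (i : ℕ)) (s + (i : ℕ)) + k ∧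
      F (cp i) (s + (i : ℕ)) = C (s + (i : ℕ)) (s + (i : ℕ)) + k ∧
      F (cp i) (cp i) = C (s + (i : ℕ)) (s + (i : ℕ)) + l) ∧
    (∀ i j : Fin n, i ≠ j →
      F (s + (i : ℕ)) (s + (j : ℕ)) = C (s + (i : ℕ)) (s + (j : ℕ)) ∧
      F (cp i) (cp j) = C (s + (i : ℕ)) (s + (j : ℕ)) + l ∧
      F (s + (i : ℕ)) (cp j) =
        C (s + (i : ℕ)) (s + (j : ℕ)) +
          (if ((ord.symm i : Fin n) : ℕ) < ((ord.symm j : Fin n) : ℕ) then k else k + 1) ∧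
      F (cp j) (s + (i : ℕ)) =
        C (s + (i : ℕ)) (s + (j : ℕ)) +
          (if ((ord.symm i : Fin n) : ℕ) < ((ord.symm j : Fin n) : ℕ) then k else k + 1)) ∧
    -- (2) the extra row of ι:
    F ι ι = l - 2 * k - 1 ∧
    (∀ a, a < s → F ι a = hsh a ∧ F a ι = hsh a) ∧
    (∀ i : Fin n, F ι (s + (i : ℕ)) = k ∧ F (s + (i : ℕ)) ι = k) ∧
    (∀ i : Fin n, F ι (cp i) = l - k - 1 ∧ F (cp i) ι = l - k - 1) := by
  intro ι Cplus F cp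
  have h0 : IsPartialSplitting_s9 s n C hsh k l (fun u => s + (ord u : ℕ)) 0 Cplus := by
    constructor <;> grind
  have h : IsPartialSplitting_s9 s n C hsh k l (fun u => s + (ord u : ℕ)) n F :=
    isPartialSplitting_iterUnlink ord hsym h0 n le_rfl
  have hcp : ∀ i, cp i = s + n + 1 + (ord.symm i : ℕ) := fun _ => rfl
  have hcplt : ∀ i, cp i < s + n + 1 + n := fun i => by have := hcp i; omega
  have hsplit : ∀ i : Fin n, F (s + (i : ℕ)) ι = k := fun i => by
    simpa using h.split_extra (ord.symm i)
  have hcopy : ∀ i : Fin n, F (cp i) ι = l - k - 1 := fun i =>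
    h.copy_extra (ord.symm i) (Fin.isLt _)
  have hspec : ∀ a, a < s → ∀ i : Fin n, F a (cp i) = C a (s + (i : ℕ)) + hsh a := by
    intro a ha i
    simpa using h.spectator_copy (ord.symm i) (Fin.isLt _) a ha
  have hsc : ∀ i j : Fin n, F (s + (i : ℕ)) (cp j) =
      C (s + (i : ℕ)) (s + (j : ℕ)) + if ord.symm i ≤ ord.symm j then k else k + 1 := by
    intro i j
    simpa only [Equiv.apply_symm_apply] using
      h.split_copy (ord.symm j) (Fin.isLt _) (ord.symm i)
  have hcc : ∀ i j : Fin n, F (cp i) (cp j) = C (s + (i : ℕ)) (s + (j : ℕ)) + l := by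
    intro i j
    simpa using h.copy_copy (ord.symm i) (ord.symm j) (Fin.isLt _) (Fin.isLt _)
  have hsc' : ∀ i j : Fin n, i ≠ j → F (s + (i : ℕ)) (cp j) = C (s + (i : ℕ)) (s + (j : ℕ)) +
      if ((ord.symm i : Fin n) : ℕ) < ((ord.symm j : Fin n) : ℕ) then k else k + 1 := by
    intro i j hij
    have hne : ord.symm i ≠ ord.symm j := ord.symm.injective.ne hij
    rw [hsc]
    simp only [← Fin.lt_def, hne.le_iff_lt]
  have hscd : ∀ i : Fin n, F (s + (i : ℕ)) (cp i) = C (s + (i : ℕ)) (s + (i : ℕ)) + k := by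
    intro i
    rw [hsc, if_pos le_rfl]
  refine ⟨fun a b ha hb => h.old a b (by omega) (by omega), fun a ha i => ?_, fun i => ?_,
    fun i j hij => ?_, h.extra_extra, fun a ha => ?_, fun i => ?_, fun i => ?_⟩
  · exact ⟨h.old _ _ (by omega) (by omega), h.old _ _ (by omega) (by omega), hspec a ha i,
      (h.symm _ _ (hcplt i) (by omega)).trans (hspec a ha i)⟩
  · exact ⟨h.old _ _ (by omega) (by omega), hscd i,
      (h.symm _ _ (hcplt i) (by omega)).trans (hscd i), hcc i i⟩
  · exact ⟨h.old _ _ (by omega) (by omega), hcc i j, hsc' i j hij,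
      (h.symm _ _ (hcplt j) (by omega)).trans (hsc' i j hij)⟩
  · exact ⟨(h.symm _ _ (by omega) (by omega)).trans (h.spectator_extra a ha),
      h.spectator_extra a ha⟩
  · exact ⟨(h.symm _ _ (by omega) (by omega)).trans (hsplit i), hsplit i⟩
  · exact ⟨(h.symm _ _ (by omega) (hcplt i)).trans (hcopy i), hcopy i⟩
end

section
/- (Recursive linking realizes (k,2k)-splitting.) In the setting of the splitting-by-linking proposition, suppose l = 2k. Then after performing the n linkings L(i,ι) on the augmented matrix C⁺ (whose extra row has diagonal entry l − 2k = 0, entry h_s at each spectator and entry k at each split node), the extra row of the resulting matrix has diagonal entry 0, entry h_s at each old spectator, entry k + 1 at each old split node, and entry l − k = k at each newly created copy i′. Hence the resulting matrix is itself of the augmented form required by the splitting-by-linking procedure, with the n copies i′ as the new designated split nodes, the old split nodes as spectators with shift k + 1, the old spectators retaining their shifts, and the same parameters k and l = 2k; consequently, the linking procedure can be iterated, and for every i ≥ 1 the i-th iterate with the extra index deleted equals the i-fold iterated (k,2k)-splitting of C (each iteration splitting the n nodes created at the previous step). -/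
/-- One round of `n` linkings `L(·,ι)` of the nodes `pb, pb+1, …, pb+n-1` with the node
`ι`, in the order prescribed by `σ` (at time `t` the node `pb + σ t` is linked, the new
index being appended at position `nb + t`). -/
def roundLink (ι pb nb n : ℕ) (σ : Equiv.Perm (Fin n)) (C : ℕ → ℕ → ℤ) : ℕ → ℕ → ℕ → ℤ
  | 0 => C
  | t + 1 =>
      if h : t < n then
        linkAt (nb + t) (pb + ((σ ⟨t, h⟩ : Fin n) : ℕ)) ι (roundLink ι pb nb n σ C t)
      else roundLink ι pb nb n σ C t

/-- Iterated rounds of linkings with the extra node `ι = s + n`: round `r+1` links the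
`n` nodes created in round `r` (the original split nodes `s,…,s+n-1` when `r = 0`)
with `ι`, in the order prescribed by `ords r`, appending the new indices at positions
`s+n+1+rn, …, s+n+1+rn+n-1`. -/
def iterRounds (s n : ℕ) (ords : ℕ → Equiv.Perm (Fin n)) (Cp : ℕ → ℕ → ℤ) :
    ℕ → ℕ → ℕ → ℤ
  | 0 => Cp
  | r + 1 =>
      roundLink (s + n) (if r = 0 then s else s + n + 1 + (r - 1) * n)
        (s + n + 1 + r * n) n (ords r) (iterRounds s n ords Cp r) n

/-- One `(k,l)`-splitting step on a quiver matrix encoded as `ℕ → ℕ → ℤ`: the split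
nodes are `b, b+1, …, b+n-1`, the spectators are the indices `< b` with shifts `hsh`,
the copy of the split node `b+u` is placed at `b+n+π(u)`, and the permutation datum of
the splitting assigns the value `σ u` to the split node `b+u`. -/
def splitStep (b n : ℕ) (k l : ℤ) (hsh : ℕ → ℤ) (π : Equiv.Perm (Fin n))
    (σ : Fin n → Fin n) (C : ℕ → ℕ → ℤ) : ℕ → ℕ → ℤ := fun a c =>
  if ha : b + n ≤ a ∧ a < b + n + n then
    let u : Fin n := π.symm ⟨a - (b + n), by omega⟩
    if hc : b + n ≤ c ∧ c < b + n + n then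
      let v : Fin n := π.symm ⟨c - (b + n), by omega⟩
      C (b + (u : ℕ)) (b + (v : ℕ)) + l
    else if hc2 : b ≤ c ∧ c < b + n then
      let v : Fin n := ⟨c - b, by omega⟩
      if v = u then C (b + (u : ℕ)) (b + (u : ℕ)) + k
      else C (b + (u : ℕ)) (b + (v : ℕ)) + (if σ u < σ v then k + 1 else k)
    else C (b + (u : ℕ)) c + hsh c
  else if hc : b + n ≤ c ∧ c < b + n + n then
    let v : Fin n := π.symm ⟨c - (b + n), by omega⟩
    if ha2 : b ≤ a ∧ a < b + n then
      let u : Fin n := ⟨a - b, by omega⟩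
      if u = v then C (b + (v : ℕ)) (b + (v : ℕ)) + k
      else C (b + (u : ℕ)) (b + (v : ℕ)) + (if σ u < σ v then k else k + 1)
    else C a (b + (v : ℕ)) + hsh a
  else C a c

/-- The `i`-fold iterated `(k,l)`-splitting of `C`, each round splitting the `n` nodes
created at the previous round: round `r+1` splits the block `s+rn, …, s+rn+n-1`, the
original spectators keep their shifts `hs0` and all other previous nodes become
spectators with shift `k+1`; the placement of the copies and the permutation of the
splitting are the ones induced by the linking order `ords r` (nodes linked earlier get
larger permutation values, whence `σ = Fin.rev ∘ π`). -/
def iterSplit (s n : ℕ) (k l : ℤ) (hs0 : ℕ → ℤ) (ords : ℕ → Equiv.Perm (Fin n))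
    (C : ℕ → ℕ → ℤ) : ℕ → ℕ → ℕ → ℤ
  | 0 => C
  | r + 1 =>
      splitStep (s + r * n) n k l (fun a => if a < s then hs0 a else k + 1)
        (ords r).symm (fun u => Fin.rev ((ords r).symm u))
        (iterSplit s n k l hs0 ords C r)

/-- Symmetry of the leading `N × N` block. -/
def SymmBelow (N : ℕ) (C : ℕ → ℕ → ℤ) : Prop :=
  ∀ a b, a < N → b < N → C a b = C b a

theorem SymmBelow.linkAt {ν i j : ℕ} {C : ℕ → ℕ → ℤ} (h : SymmBelow ν C) :
    SymmBelow (ν + 1) (linkAt ν i j C) := by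
  intro a b ha hb
  by_cases h1 : a = ν <;> by_cases h2 : b = ν
  · subst h1 h2; rfl
  · simp [_root_.linkAt, h1, h2]
  · simp [_root_.linkAt, h1, h2]
  · have := h a b (by omega) (by omega)
    simp only [_root_.linkAt, h1, h2, if_false, this]
    congr 1
    exact propext (by tauto)

/-- The entries of a matrix `R` obtained from `D` by linking the nodes `pb + σ 0`, …,
`pb + σ (t - 1)` with `ι`, the new indices being `nb`, …, `nb + t - 1`. -/
structure IsPartialRound (ι pb nb n : ℕ) (k : ℤ) (σ : Equiv.Perm (Fin n))
    (D : ℕ → ℕ → ℤ) (t : ℕ) (R : ℕ → ℕ → ℤ) : Prop where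
  symm : SymmBelow (nb + t) R
  old_old : ∀ a b, a < nb → b < nb → a ≠ ι → b ≠ ι → R a b = D a b
  diag : R ι ι = 0
  extra_spectator : ∀ a, a < nb → a ≠ ι → (a < pb ∨ pb + n ≤ a) → R ι a = D ι a
  extra_split : ∀ j : Fin n, R ι (pb + σ j) = if (j : ℕ) < t then k + 1 else k
  extra_copy : ∀ j : Fin n, (j : ℕ) < t → R ι (nb + j) = k
  copy_copy : ∀ i j : Fin n, (i : ℕ) < t → (j : ℕ) < t →
    R (nb + i) (nb + j) = D (pb + σ i) (pb + σ j) + 2 * k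
  copy_spectator : ∀ (j : Fin n) (a : ℕ), (j : ℕ) < t → a < nb → a ≠ ι →
    (a < pb ∨ pb + n ≤ a) → R (nb + j) a = D (pb + σ j) a + D ι a
  copy_split : ∀ i j : Fin n, (i : ℕ) < t →
    R (nb + i) (pb + σ j) = D (pb + σ i) (pb + σ j) + if j < i then k + 1 else k

theorem IsPartialRound.succ {ι pb nb n : ℕ} {k : ℤ} {σ : Equiv.Perm (Fin n)}
    {D R : ℕ → ℕ → ℤ} {t : ℕ} (hι : ι < nb) (hpb : pb + n ≤ nb)
    (hιb : ι < pb ∨ pb + n ≤ ι) (ht : t < n) (h : IsPartialRound ι pb nb n k σ D t R) :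
    IsPartialRound ι pb nb n k σ D (t + 1) (linkAt (nb + t) (pb + σ ⟨t, ht⟩) ι R) := by
  have hlt : ∀ j : Fin n, (σ j : ℕ) < n := fun j => (σ j).2
  have hinj : ∀ i j : Fin n, (σ i : ℕ) = σ j ↔ (i : ℕ) = j := fun i j => by
    rw [← Fin.ext_iff, ← Fin.ext_iff, σ.injective.eq_iff]
  have hτ := hlt ⟨t, ht⟩
  have hxι := h.extra_split ⟨t, ht⟩
  have hxι' : R (pb + σ ⟨t, ht⟩) ι = k := by
    rw [h.symm _ _ (by omega) (by omega), hxι]; simp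
  constructor
  · exact h.symm.linkAt
  · intro a b ha hb ha' hb'
    have := h.old_old a b ha hb ha' hb'
    grind [linkAt]
  · have := h.diag
    grind [linkAt]
  · intro a ha ha' hs
    have := h.extra_spectator a ha ha' hs
    grind [linkAt]
  · intro j
    have h1 := h.extra_split j
    have h2 := hinj j ⟨t, ht⟩
    have h3 := hlt j
    grind [linkAt]
  · intro j hj
    have h1 := h.extra_copy j
    have h2 := h.diag
    grind [linkAt]
  · intro i j hi hj
    have oo := fun i j : Fin n => h.old_old (pb + σ i) (pb + σ j) (by have := hlt i; omega)
      (by have := hlt j; omega) (by have := hlt i; omega) (by have := hlt j; omega)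
    have hs := fun i j : Fin n => fun hi : (i : ℕ) < t =>
      h.symm (pb + σ j) (nb + i) (by have := hlt j; omega) (by omega)
    rcases Nat.lt_succ_iff_lt_or_eq.1 hi with hi | hi <;>
      rcases Nat.lt_succ_iff_lt_or_eq.1 hj with hj | hj
    · have := h.copy_copy i j hi hj
      grind [linkAt]
    · obtain rfl : j = ⟨t, ht⟩ := Fin.ext hj
      have h1 := h.copy_split i ⟨t, ht⟩ hi
      have h2 := h.extra_copy i hi
      have h3 := hs i ⟨t, ht⟩ hi
      have h4 : ¬ (⟨t, ht⟩ : Fin n) < i := by rw [Fin.lt_def]; simp; omega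
      rw [if_neg h4] at h1
      have h5 : nb + (i : ℕ) ≠ nb + t := by omega
      have h6 : nb + (i : ℕ) ≠ pb + σ ⟨t, ht⟩ := by omega
      have h7 : nb + (i : ℕ) ≠ ι := by omega
      simp only [linkAt, h5, h6, h7, if_false, if_true]
      linarith
    · obtain rfl : i = ⟨t, ht⟩ := Fin.ext hi
      have h1 := h.copy_split j ⟨t, ht⟩ hj
      have h2 := h.extra_copy j hj
      have h3 := hs j ⟨t, ht⟩ hj
      have h4 : ¬ (⟨t, ht⟩ : Fin n) < j := by rw [Fin.lt_def]; simp; omega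
      rw [if_neg h4] at h1
      have h5 : nb + (j : ℕ) ≠ nb + t := by omega
      have h6 : nb + (j : ℕ) ≠ pb + σ ⟨t, ht⟩ := by omega
      have h7 : nb + (j : ℕ) ≠ ι := by omega
      have h8 := oo ⟨t, ht⟩ j
      have h9 := oo j ⟨t, ht⟩
      have h10 := h.symm (pb + σ ⟨t, ht⟩) (pb + σ j) (by omega) (by omega)
      simp only [linkAt, h5, h6, h7, if_false, if_true]
      linarith
    · obtain rfl : i = ⟨t, ht⟩ := Fin.ext hi
      obtain rfl : j = ⟨t, ht⟩ := Fin.ext hj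
      have h1 := oo ⟨t, ht⟩ ⟨t, ht⟩
      have h2 := h.diag
      simp only [linkAt, if_true]
      linarith
  · intro j a hj ha ha' hs
    have h1 := h.extra_spectator a ha ha' hs
    have h2 := h.old_old (pb + σ ⟨t, ht⟩) a (by omega) ha (by omega) ha'
    rcases Nat.lt_succ_iff_lt_or_eq.1 hj with hj | hj
    · have := h.copy_spectator j a hj ha ha' hs
      grind [linkAt]
    · obtain rfl : j = ⟨t, ht⟩ := Fin.ext hj
      grind [linkAt]
  · intro i j hi
    have h1 := h.extra_split j
    have h2 := hlt j
    have h3 := hinj j ⟨t, ht⟩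
    have h4 := h.old_old (pb + σ ⟨t, ht⟩) (pb + σ j) (by omega) (by omega) (by omega) (by omega)
    rcases Nat.lt_succ_iff_lt_or_eq.1 hi with hi | hi
    · have := h.copy_split i j hi
      grind [linkAt]
    · obtain rfl : i = ⟨t, ht⟩ := Fin.ext hi
      simp only [Fin.lt_def]
      grind [linkAt]

theorem isPartialRound_roundLink {ι pb nb n : ℕ} {k : ℤ} (σ : Equiv.Perm (Fin n))
    {D : ℕ → ℕ → ℤ} (hι : ι < nb) (hpb : pb + n ≤ nb) (hιb : ι < pb ∨ pb + n ≤ ι)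
    (hD : SymmBelow nb D) (hdiag : D ι ι = 0) (hk : ∀ u : Fin n, D ι (pb + u) = k)
    (t : ℕ) (ht : t ≤ n) :
    IsPartialRound ι pb nb n k σ D t (roundLink ι pb nb n σ D t) := by
  induction t with
  | zero => constructor <;> simp [roundLink, hD, hdiag, hk]
  | succ t ih =>
    rw [roundLink, dif_pos (by omega)]
    exact (ih (by omega)).succ hι hpb hιb (by omega)

section SplitStep

variable {b n : ℕ} {k l : ℤ} {h : ℕ → ℤ} {σ : Equiv.Perm (Fin n)} {S : ℕ → ℕ → ℤ}

theorem splitStep_copy_copy (i j : Fin n) :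
    splitStep b n k l h σ.symm (fun u => Fin.rev (σ.symm u)) S (b + n + i) (b + n + j) =
      S (b + σ i) (b + σ j) + l := by
  simp [splitStep]

theorem splitStep_copy_split (i j : Fin n) :
    splitStep b n k l h σ.symm (fun u => Fin.rev (σ.symm u)) S (b + n + i) (b + σ j) =
      S (b + σ i) (b + σ j) + if j < i then k + 1 else k := by
  have hi : b + n ≤ b + n + (i : ℕ) ∧ b + n + (i : ℕ) < b + n + n := by omega
  have hj : ¬ (b + n ≤ b + (σ j : ℕ) ∧ b + (σ j : ℕ) < b + n + n) := by omega
  have hj' : b ≤ b + (σ j : ℕ) ∧ b + (σ j : ℕ) < b + n := by omega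
  rw [splitStep, dif_pos hi, dif_neg hj, dif_pos hj']
  by_cases hij : j = i
  · subst hij; simp
  · simp [hij]

theorem splitStep_copy_spectator (i : Fin n) {c : ℕ} (hc : c < b) :
    splitStep b n k l h σ.symm (fun u => Fin.rev (σ.symm u)) S (b + n + i) c =
      S (b + σ i) c + h c := by
  have hi : b + n ≤ b + n + (i : ℕ) ∧ b + n + (i : ℕ) < b + n + n := by omega
  rw [splitStep, dif_pos hi, dif_neg (by omega), dif_neg (by omega)]
  simp

theorem splitStep_old_old {a c : ℕ} (ha : a < b + n) (hc : c < b + n) :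
    splitStep b n k l h σ.symm (fun u => Fin.rev (σ.symm u)) S a c = S a c := by
  rw [splitStep, dif_neg (by omega), dif_neg (by omega)]

theorem splitStep_old_copy (hS : SymmBelow (b + n) S) {a : ℕ} (ha : a < b + n) (j : Fin n) :
    splitStep b n k l h σ.symm (fun u => Fin.rev (σ.symm u)) S a (b + n + j) =
      splitStep b n k l h σ.symm (fun u => Fin.rev (σ.symm u)) S (b + n + j) a := by
  have hj : b + n ≤ b + n + (j : ℕ) ∧ b + n + (j : ℕ) < b + n + n := by omega
  have hs := hS a (b + σ j) ha (by omega)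
  by_cases hb : b ≤ a
  · obtain ⟨i, rfl⟩ : ∃ i : Fin n, a = b + σ i :=
      ⟨σ.symm ⟨a - b, by omega⟩, by simp; omega⟩
    rw [splitStep_copy_split, splitStep, dif_neg (by omega), dif_pos hj, dif_pos (by omega)]
    by_cases hij : i = j
    · subst hij; simp
    · rcases lt_or_gt_of_ne hij with hlt | hlt <;> simp [hij, hs, hlt, hlt.not_gt]
  · rw [splitStep_copy_spectator j (by omega), splitStep, dif_neg (by omega), dif_pos hj,
      dif_neg (by omega)]
    simp [hs]

end SplitStep

/-- The matrix `F` is the augmentation of `S` after `m / n` rounds: the extra index is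
`s + n`, the split nodes are the last `n` nodes, the first `s` nodes have shifts `h`, and
the remaining spectators have shift `k + 1`. -/
structure IsAugmentation (s n m : ℕ) (k : ℤ) (h : ℕ → ℤ) (S F : ℕ → ℕ → ℤ) : Prop where
  symm : SymmBelow (s + n + 1 + m) F
  entry : ∀ a b, a < s + n + m → b < s + n + m →
    F (if a < s + n then a else a + 1) (if b < s + n then b else b + 1) = S a b
  diag : F (s + n) (s + n) = 0
  extra : ∀ a, a < s + n + m → F (s + n) (if a < s + n then a else a + 1) =
    if a < s then h a else if a < s + m then k + 1 else k

theorem IsAugmentation.step {s n m pb : ℕ} {k l : ℤ} {h : ℕ → ℤ} {S F : ℕ → ℕ → ℤ}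
    (hl : l = 2 * k) (hF : IsAugmentation s n m k h S F) (σ : Equiv.Perm (Fin n))
    (hpb : ∀ u : ℕ, u < n → (if s + m + u < s + n then s + m + u else s + m + u + 1) = pb + u)
    (hle : pb + n ≤ s + n + 1 + m) (hι : s + n < pb ∨ pb + n ≤ s + n) :
    IsAugmentation s n (m + n) k h
      (splitStep (s + m) n k l (fun a => if a < s then h a else k + 1) σ.symm
        (fun u => Fin.rev (σ.symm u)) S)
      (roundLink (s + n) pb (s + n + 1 + m) n σ F n) := by
  have hk : ∀ u : Fin n, F (s + n) (pb + u) = k := fun u => by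
    rw [← hpb u u.2, hF.extra _ (by omega)]
    grind
  have R := isPartialRound_roundLink σ (by omega) hle hι hF.symm hF.diag hk n le_rfl
  set e : ℕ → ℕ := fun a => if a < s + n then a else a + 1
  have e_split (j : Fin n) : e (s + m + σ j) = pb + σ j := hpb _ (σ j).2
  have e_copy (j : Fin n) : e (s + m + n + j) = s + n + 1 + m + j := by grind
  have e_ne (a : ℕ) : e a ≠ s + n := by grind
  have e_lt {a : ℕ} (ha : a < s + m + n) : e a < s + n + 1 + m := by grind
  have e_spec {a : ℕ} (ha : a < s + m) : e a < pb ∨ pb + n ≤ e a := by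
    rcases Nat.eq_zero_or_pos n with hn | hn
    · omega
    · have := hpb 0 hn
      grind
  have hcases {a : ℕ} (ha : a < s + n + (m + n)) :
      a < s + m ∨ (∃ j : Fin n, a = s + m + σ j) ∨ ∃ j : Fin n, a = s + m + n + j := by
    by_cases h1 : a < s + m
    · exact .inl h1
    · by_cases h2 : a < s + m + n
      · exact .inr (.inl ⟨σ.symm ⟨a - (s + m), by omega⟩, by simp; omega⟩)
      · exact .inr (.inr ⟨⟨a - (s + m + n), by omega⟩, by simp; omega⟩)
  have hentry {a b : ℕ} (ha : a < s + m + n) (hb : b < s + m + n) : F (e a) (e b) = S a b :=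
    hF.entry a b (by omega) (by omega)
  have hS : SymmBelow (s + m + n) S := fun a b ha hb => by
    rw [← hentry ha hb, ← hentry hb ha, hF.symm _ _ (e_lt ha) (e_lt hb)]
  have hsplit (i : Fin n) : s + m + (σ i : ℕ) < s + m + n := by omega
  have hcopy (i : Fin n) {b : ℕ} (hb : b < s + n + (m + n)) :
      roundLink (s + n) pb (s + n + 1 + m) n σ F n (e (s + m + n + i)) (e b) =
        splitStep (s + m) n k l (fun a => if a < s then h a else k + 1) σ.symm
          (fun u => Fin.rev (σ.symm u)) S (s + m + n + i) b := by
    rw [e_copy]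
    rcases hcases hb with hb | ⟨j, rfl⟩ | ⟨j, rfl⟩
    · rw [splitStep_copy_spectator i hb,
        R.copy_spectator i _ i.2 (e_lt (by omega)) (e_ne b) (e_spec hb), ← e_split,
        hentry (hsplit i) (by omega), hF.extra b (by omega), if_pos hb]
    · rw [splitStep_copy_split, e_split, R.copy_split i j i.2, ← e_split, ← e_split,
        hentry (hsplit i) (hsplit j)]
    · rw [splitStep_copy_copy, e_copy, R.copy_copy i j i.2 j.2, ← e_split, ← e_split,
        hentry (hsplit i) (hsplit j), hl]
  refine ⟨?_, fun a b ha hb => ?_, R.diag, fun a ha => ?_⟩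
  · have := R.symm
    rwa [add_assoc (s + n + 1)] at this
  · change roundLink _ _ _ _ _ _ _ (e a) (e b) = _
    by_cases ha' : a < s + m + n
    · by_cases hb' : b < s + m + n
      · rw [splitStep_old_old ha' hb',
          R.old_old _ _ (e_lt ha') (e_lt hb') (e_ne a) (e_ne b), hentry ha' hb']
      · obtain ⟨j, rfl⟩ : ∃ j : Fin n, b = s + m + n + j :=
          ⟨⟨b - (s + m + n), by omega⟩, by simp; omega⟩
        have := e_lt ha'
        rw [splitStep_old_copy hS ha', ← hcopy j ha]
        exact R.symm _ _ (by omega) (by rw [e_copy]; omega)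
    · obtain ⟨i, rfl⟩ : ∃ i : Fin n, a = s + m + n + i :=
        ⟨⟨a - (s + m + n), by omega⟩, by simp; omega⟩
      exact hcopy i hb
  · change roundLink _ _ _ _ _ _ _ _ (e a) = _
    rcases hcases ha with ha | ⟨j, rfl⟩ | ⟨j, rfl⟩
    · rw [R.extra_spectator _ (e_lt (by omega)) (e_ne a) (e_spec ha), hF.extra a (by omega)]
      simp [ha, show a < s + (m + n) by omega]
    · rw [e_split, R.extra_split, if_pos j.2, if_neg (by omega), if_pos (by omega)]
    · rw [e_copy, R.extra_copy j j.2, if_neg (by omega), if_neg (by omega)]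

/-- **Recursive linking realizes `(k,2k)`-splitting.**  In the splitting-by-linking
setting with `l = 2k`, after one round of the `n` linkings `L(i,ι)` on the augmented
matrix `C⁺` (extra row: diagonal `l - 2k = 0`, `hs0` at spectators, `k` at split
nodes), the extra row of the result has diagonal `0`, entries `hs0` at the old
spectators, `k + 1` at the old split nodes and `l - k = k` at the new copies; hence the
result is again of the augmented form and the procedure iterates: for every `i ≥ 1`
the `i`-th iterate with the extra index `ι = s+n` deleted equals the `i`-fold iterated
`(k,2k)`-splitting of `C`, each iteration splitting the `n` nodes created at the
previous step. -/
theorem recursive_linking_realizes_splitting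
    (s n : ℕ) (C : ℕ → ℕ → ℤ)
    (hsym : ∀ a b, a < s + n → b < s + n → C a b = C b a)
    (hs0 : ℕ → ℤ) (k l : ℤ) (hl : l = 2 * k)
    (ords : ℕ → Equiv.Perm (Fin n)) :
    let ι := s + n
    let Cplus : ℕ → ℕ → ℤ := fun a b =>
      if a = ι then (if b = ι then l - 2 * k else if b < s then hs0 b else k)
      else if b = ι then (if a < s then hs0 a else k)
      else C a b
    let F1 := iterRounds s n ords Cplus 1
    let cp0 : Fin n → ℕ := fun i => s + n + 1 + (((ords 0).symm i : Fin n) : ℕ)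
    -- (a) the extra row after one round of linkings:
    (F1 ι ι = l - 2 * k ∧
     (∀ a, a < s → F1 ι a = hs0 a) ∧
     (∀ i : Fin n, F1 ι (s + (i : ℕ)) = k + 1) ∧
     (∀ i : Fin n, F1 ι (cp0 i) = l - k)) ∧
    -- (b) the iterated linking with ι deleted is the iterated (k,2k)-splitting:
    (∀ i : ℕ, 1 ≤ i → ∀ a b : ℕ, a < s + n + i * n → b < s + n + i * n →
      iterRounds s n ords Cplus i (if a < s + n then a else a + 1)
          (if b < s + n then b else b + 1) =
        iterSplit s n k l hs0 ords C i a b) := by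
  intro ι Cplus F1 cp0
  have hinv (r : ℕ) : IsAugmentation s n (r * n) k hs0 (iterSplit s n k l hs0 ords C r)
      (iterRounds s n ords Cplus r) := by
    induction r with
    | zero =>
      constructor
      · intro a b ha hb
        have := hsym a b
        grind [iterRounds]
      · intro a b ha hb
        rw [if_pos (by omega), if_pos (by omega)]
        change (if a = s + n then _ else if b = s + n then _ else C a b) = C a b
        rw [if_neg (by omega), if_neg (by omega)]
      · grind [iterRounds]
      · intro a ha
        grind [iterRounds]
    | succ r ih =>
      rw [iterSplit, iterRounds, Nat.succ_mul]
      rcases r with _ | r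
      · exact ih.step hl (ords 0) (fun u hu => by simp; omega) (by simp) (by simp)
      · rw [Nat.succ_mul] at ih ⊢
        simp only [Nat.add_sub_cancel, Nat.add_eq_zero_iff, one_ne_zero, and_false, if_false]
        exact ih.step hl (ords (r + 1)) (fun u hu => by rw [if_neg (by omega)]; omega)
          (by omega) (by omega)
  have h1 := hinv 1
  rw [one_mul] at h1
  refine ⟨⟨h1.diag.trans (by omega), fun a ha => ?_, fun i => ?_, fun i => ?_⟩,
    fun i _ => (hinv i).entry⟩
  · have := h1.extra a (by omega)
    rwa [if_pos (by omega), if_pos ha] at this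
  · have := h1.extra (s + i) (by omega)
    rwa [if_pos (by omega), if_neg (by omega), if_pos (by omega)] at this
  · have := h1.extra (s + n + (ords 0).symm i) (by omega)
    rw [if_neg (by omega), if_neg (by omega), if_neg (by omega), add_right_comm] at this
    exact this.trans (by omega)
end

section
/- Let R be a commutative ring, let q ∈ R be invertible, and let a ∈ R. For every integer j ≥ 1, the following identity holds: Σ over all weakly decreasing sequences 2 ≥ k_1 ≥ k_2 ≥ ⋯ ≥ k_j ≥ 0 of [2 choose k_1]·Π_{i=1}^{j−1}[k_i choose k_{i+1}] · q^{10(k_1+⋯+k_j) − 4k_1 − 2Σ_{i=1}^{j−1} k_i k_{i+1}} · Π_{i=1}^{k_1}(1 − a²q^{2(i−2)}) = 1 + (1−a²q⁻²)(1−a²)·Σ_{α=1}^{j} q^{12α} + (1−a²q⁻²)(1+q²)·Σ_{β=1}^{j} q^{8β−2} + (1−a²q⁻²)(1−a²)(1+q²)·Σ_{α≥1, β≥1, α+β≤j} q^{12α+8β−2}. (The left-hand side is the normalized Sym²-coloured HOMFLY-PT polynomial of the (2,2j+1) torus knot; the q-binomials are with respect to the quantum integers [n] = 1+q²+⋯+q^{2(n−1)},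 so the only nontrivial binomial occurring is [2 choose 1] = 1+q².) -/
/-- The q-binomial coefficient `[n choose k]` with respect to the quantum integers
`[n] = 1 + q² + ⋯ + q^{2(n-1)}`, defined via the q-Pascal recursion
`[n+1 choose k+1] = [n choose k] + q^{2(k+1)} [n choose k+1]`. -/
def qbinom {R : Type*} [CommRing R] (q : R) : ℕ → ℕ → R
  | _, 0 => 1
  | 0, _ + 1 => 0
  | n + 1, kk + 1 => qbinom q n kk + q ^ (2 * (kk + 1)) * qbinom q n (kk + 1)

/-- Extend a sequence `k : Fin j → Fin 3` to all of `ℕ` (by zero). -/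
def extSeq (j : ℕ) (k : Fin j → Fin 3) : ℕ → ℕ :=
  fun i => if h : i < j then ((k ⟨i, h⟩ : Fin 3) : ℕ) else 0

/-- The weight of a step from `c` to `m` in a chain. -/
def stepWeight {R : Type*} [CommRing R] (u : Rˣ) (c m : ℕ) : R :=
  qbinom (u : R) c m * ((u ^ (10 * (m : ℤ) - 2 * ((c : ℤ) * (m : ℤ))) : Rˣ) : R)

/-- The total weight of all chains with `n` steps starting from `c`. -/
def chainWeight {R : Type*} [CommRing R] (u : Rˣ) : ℕ → ℕ → R
  | 0, _ => 1
  | n + 1, c => ∑ m : Fin 3, stepWeight u c m * chainWeight u n m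

lemma qbinom_eq_zero_of_lt {R : Type*} [CommRing R] (q : R) :
    ∀ n k : ℕ, n < k → qbinom q n k = 0
  | _, 0, h => absurd h (Nat.not_lt_zero _)
  | 0, _ + 1, _ => rfl
  | n + 1, k + 1, h => by
    rw [qbinom, qbinom_eq_zero_of_lt q n k (by omega),
      qbinom_eq_zero_of_lt q n (k + 1) (by omega), mul_zero, add_zero]

lemma sum_prod_stepWeight {R : Type*} [CommRing R] (u : Rˣ) (n : ℕ) (c : Fin 3) :
    ∑ k : Fin n → Fin 3, ∏ i : Fin n,
      stepWeight u ((Fin.cons c k : Fin (n + 1) → Fin 3) i.castSucc : Fin 3) (k i : Fin 3) =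
      chainWeight u n c := by
  induction n generalizing c with
  | zero => simp [chainWeight]
  | succ n ih =>
    rw [← (Fin.consEquiv fun _ : Fin (n + 1) => Fin 3).sum_comp, Fintype.sum_prod_type,
      chainWeight]
    refine Finset.sum_congr rfl fun m _ => ?_
    rw [← ih m, Finset.mul_sum]
    refine Finset.sum_congr rfl fun k _ => ?_
    simp [Fin.consEquiv, Fin.prod_univ_succ]

lemma prod_qbinom_mul_zpow {R : Type*} [CommRing R] (u : Rˣ) (e : ℕ → ℕ) (n : ℕ) :
    (∏ i ∈ Finset.range n, qbinom (u : R) (e i) (e (i + 1))) *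
      ((u ^ (10 * (∑ i ∈ Finset.range (n + 1), (e i : ℤ)) - 4 * (e 0 : ℤ) -
        2 * ∑ i ∈ Finset.range n, (e i : ℤ) * (e (i + 1) : ℤ)) : Rˣ) : R) =
      ((u ^ (6 * (e 0 : ℤ)) : Rˣ) : R) *
        ∏ i ∈ Finset.range n, stepWeight u (e i) (e (i + 1)) := by
  induction n with
  | zero =>
    simp only [Finset.range_zero, Finset.prod_empty, Finset.sum_empty, zero_add,
      Finset.sum_range_one, one_mul, mul_one]
    congr 2
    ring
  | succ n ih =>
    rw [Finset.prod_range_succ, Finset.prod_range_succ, ← mul_assoc, ← ih, stepWeight,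
      Finset.sum_range_succ _ (n + 1), Finset.sum_range_succ (fun i => (e i : ℤ) * _)]
    rw [show ∀ s t x y z : ℤ, 10 * (s + x) - 4 * z - 2 * (t + y * x) =
      (10 * s - 4 * z - 2 * t) + (10 * x - 2 * (y * x)) by intros; ring, zpow_add, Units.val_mul]
    ring

lemma chainWeight_zero_right {R : Type*} [CommRing R] (u : Rˣ) (n : ℕ) :
    (chainWeight u n 0 : R) = 1 := by
  induction n with
  | zero => rfl
  | succ n ih => simp [chainWeight, Fin.sum_univ_three, stepWeight, qbinom, ih]

lemma chainWeight_succ_one {R : Type*} [CommRing R] (u : Rˣ) (n : ℕ) :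
    (chainWeight u (n + 1) 1 : R) = 1 + (u : R) ^ 8 * chainWeight u n 1 := by
  have h : u ^ (8 : ℤ) = u ^ 8 := zpow_natCast u 8
  simp [chainWeight, Fin.sum_univ_three, stepWeight, qbinom, chainWeight_zero_right, h]

lemma chainWeight_succ_two {R : Type*} [CommRing R] (u : Rˣ) (n : ℕ) :
    (chainWeight u (n + 1) 2 : R) = 1 + (1 + (u : R) ^ 2) * (u : R) ^ 6 * chainWeight u n 1 +
      (u : R) ^ 12 * chainWeight u n 2 := by
  have h : u ^ (6 : ℤ) = u ^ 6 := zpow_natCast u 6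
  have h' : u ^ (12 : ℤ) = u ^ 12 := zpow_natCast u 12
  simp [chainWeight, Fin.sum_univ_three, stepWeight, qbinom, chainWeight_zero_right, h, h']

lemma chainWeight_one_right {R : Type*} [CommRing R] (u : Rˣ) (n : ℕ) :
    (chainWeight u n 1 : R) = ∑ β ∈ Finset.range (n + 1), (u : R) ^ (8 * β) := by
  induction n with
  | zero => simp [chainWeight]
  | succ n ih =>
    rw [chainWeight_succ_one, ih, Finset.sum_range_succ' _ (n + 1), Finset.mul_sum, add_comm]
    simp only [mul_add, pow_add, mul_zero, pow_zero, mul_one, mul_comm ((u : R) ^ 8)]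

lemma mul_chainWeight_two_right {R : Type*} [CommRing R] (u : Rˣ) (n : ℕ) :
    (u : R) ^ 12 * chainWeight u n 2 =
      ∑ α ∈ Finset.range (n + 1), (u : R) ^ (12 * (α + 1)) +
        (1 + (u : R) ^ 2) * ∑ α ∈ Finset.range n, ∑ β ∈ Finset.range (n - α),
          (u : R) ^ (12 * (α + 1) + (8 * β + 6)) := by
  induction n with
  | zero => simp [chainWeight]
  | succ n ih =>
    have hshift : ∑ α ∈ Finset.range n, ∑ β ∈ Finset.range (n - α),
        (u : R) ^ (12 * (α + 1 + 1) + (8 * β + 6)) =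
        (u : R) ^ 12 * ∑ α ∈ Finset.range n, ∑ β ∈ Finset.range (n - α),
          (u : R) ^ (12 * (α + 1) + (8 * β + 6)) := by
      simp only [Finset.mul_sum]
      exact Finset.sum_congr rfl fun α _ => Finset.sum_congr rfl fun β _ => by ring
    rw [chainWeight_succ_two, ih, chainWeight_one_right, Finset.sum_range_succ' _ (n + 1),
      Finset.sum_range_succ' (fun α => ∑ β ∈ Finset.range (n + 1 - α), _) n]
    simp only [Nat.add_sub_add_right, Nat.sub_zero, hshift]
    simp only [mul_add, pow_add, ← Finset.mul_sum, ← Finset.sum_mul]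
    ring

lemma sum_Icc_one_eq_sum_range {M : Type*} [AddCommMonoid M] (f : ℕ → M) (n : ℕ) :
    ∑ i ∈ Finset.Icc 1 n, f i = ∑ i ∈ Finset.range n, f (i + 1) := by
  rw [Finset.range_eq_Ico, Finset.sum_Ico_add' f 0 n 1, zero_add]
  rfl

lemma sum_filter_add_le_eq_sum_range {M : Type*} [AddCommMonoid M] (f : ℕ → ℕ → M) (n : ℕ) :
    ∑ p ∈ (Finset.Icc 1 (n + 1) ×ˢ Finset.Icc 1 (n + 1)).filter (fun p => p.1 + p.2 ≤ n + 1),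
      f p.1 p.2 = ∑ x ∈ Finset.range n, ∑ y ∈ Finset.range (n - x), f (x + 1) (y + 1) := by
  rw [Finset.sum_sigma']
  refine Finset.sum_bij' (fun p _ => ⟨p.1 - 1, p.2 - 1⟩) (fun s _ => (s.1 + 1, s.2 + 1))
    ?_ ?_ ?_ ?_ ?_
  · simp only [Finset.mem_filter, Finset.mem_product, Finset.mem_Icc, Finset.mem_sigma,
      Finset.mem_range]
    omega
  · simp only [Finset.mem_filter, Finset.mem_product, Finset.mem_Icc, Finset.mem_sigma,
      Finset.mem_range]
    omega
  · rintro ⟨x, y⟩ h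
    simp only [Finset.mem_filter, Finset.mem_product, Finset.mem_Icc] at h
    ext <;> simp <;> omega
  · rintro ⟨x, y⟩ h
    simp
  · rintro ⟨x, y⟩ h
    simp only [Finset.mem_filter, Finset.mem_product, Finset.mem_Icc] at h
    simp only [Nat.sub_add_cancel h.1.1.1, Nat.sub_add_cancel h.1.2.1]

lemma extSeq_val {j : ℕ} (k : Fin j → Fin 3) (i : Fin j) : extSeq j k i = k i := by
  simp [extSeq]

lemma prod_stepWeight_eq_zero {R : Type*} [CommRing R] (u : Rˣ) {n : ℕ}
    (k : Fin (n + 1) → Fin 3) (hk : ¬ Antitone k) :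
    ∏ i : Fin n, stepWeight u (k i.castSucc) (k i.succ) = (0 : R) := by
  rw [Fin.antitone_iff_succ_le] at hk
  push Not at hk
  obtain ⟨i, hi⟩ := hk
  refine Finset.prod_eq_zero (Finset.mem_univ i) ?_
  rw [stepWeight, qbinom_eq_zero_of_lt _ _ _ hi, zero_mul]

lemma chain_summand_eq {R : Type*} [CommRing R] (u : Rˣ) {n : ℕ} (k : Fin (n + 1) → Fin 3) :
    (∏ i ∈ Finset.range n,
        qbinom (u : R) (extSeq (n + 1) k i) (extSeq (n + 1) k (i + 1))) *
      ((u ^ (10 * (∑ i ∈ Finset.range (n + 1), (extSeq (n + 1) k i : ℤ)) -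
        4 * (extSeq (n + 1) k 0 : ℤ) -
        2 * ∑ i ∈ Finset.range n,
          (extSeq (n + 1) k i : ℤ) * (extSeq (n + 1) k (i + 1) : ℤ)) : Rˣ) : R) =
      ((u ^ (6 * ((k 0 : ℕ) : ℤ)) : Rˣ) : R) *
        ∏ i : Fin n, stepWeight u (k i.castSucc) (k i.succ) := by
  rw [prod_qbinom_mul_zpow, Finset.prod_range, show extSeq (n + 1) k 0 = k 0 from extSeq_val k 0]
  simp only [← extSeq_val, Fin.val_castSucc, Fin.val_succ]

/-- The chain-sum formula for the shifted `Sym²`-coloured HOMFLY-PT polynomial of the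
torus knot `T(2,2j+1)`, rewritten via `α = #{i : k_i = 2}` and `β = #{i : k_i = 1}`:
for every commutative ring `R`, invertible `q = u ∈ Rˣ`, `a ∈ R` and `j ≥ 1`,
the sum over weakly decreasing sequences `2 ≥ k₁ ≥ ⋯ ≥ k_j ≥ 0` of
`[2 choose k₁] ∏ [k_i choose k_{i+1}] · q^{10Σk - 4k₁ - 2Σ k_i k_{i+1}} ·
∏_{i=1}^{k₁}(1 - a²q^{2(i-2)})` equals
`1 + (1-a²q⁻²)(1-a²) Σ_{α=1}^{j} q^{12α} + (1-a²q⁻²)(1+q²) Σ_{β=1}^{j} q^{8β-2}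
 + (1-a²q⁻²)(1-a²)(1+q²) Σ_{α,β ≥ 1, α+β ≤ j} q^{12α+8β-2}`. -/
theorem torus_knot_sym2_chain_sum_identity
    {R : Type*} [CommRing R] (a : R) (u : Rˣ) (j : ℕ) (hj : 1 ≤ j) :
    ∑ k ∈ Finset.univ.filter
        (fun k : Fin j → Fin 3 => ∀ i i' : Fin j, i ≤ i' → k i' ≤ k i),
      qbinom (u : R) 2 (extSeq j k 0) *
        (∏ i ∈ Finset.range (j - 1), qbinom (u : R) (extSeq j k i) (extSeq j k (i + 1))) *
        ((u ^ (10 * (∑ i ∈ Finset.range j, (extSeq j k i : ℤ)) -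
            4 * (extSeq j k 0 : ℤ) -
            2 * ∑ i ∈ Finset.range (j - 1),
              (extSeq j k i : ℤ) * (extSeq j k (i + 1) : ℤ)) : Rˣ) : R) *
        ∏ i ∈ Finset.range (extSeq j k 0),
          (1 - a ^ 2 * ((u ^ (2 * (i : ℤ) - 2) : Rˣ) : R)) =
      1 +
        (1 - a ^ 2 * ((u ^ (-2 : ℤ) : Rˣ) : R)) * (1 - a ^ 2) *
          ∑ α ∈ Finset.Icc 1 j, (u : R) ^ (12 * α) +
        (1 - a ^ 2 * ((u ^ (-2 : ℤ) : Rˣ) : R)) * (1 + (u : R) ^ 2) *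
          ∑ β ∈ Finset.Icc 1 j, (u : R) ^ (8 * β - 2) +
        (1 - a ^ 2 * ((u ^ (-2 : ℤ) : Rˣ) : R)) * (1 - a ^ 2) * (1 + (u : R) ^ 2) *
          ∑ p ∈ (Finset.Icc 1 j ×ˢ Finset.Icc 1 j).filter (fun p => p.1 + p.2 ≤ j),
            (u : R) ^ (12 * p.1 + 8 * p.2 - 2) := by
  obtain ⟨n, rfl⟩ : ∃ n, j = n + 1 := ⟨j - 1, by omega⟩
  have hsum (g : Fin 3 → R) :
      ∑ k ∈ Finset.univ.filter
        (fun k : Fin (n + 1) → Fin 3 => ∀ i i' : Fin (n + 1), i ≤ i' → k i' ≤ k i),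
        g (k 0) * ∏ i : Fin n, stepWeight u (k i.castSucc) (k i.succ) =
      ∑ m : Fin 3, g m * chainWeight u n m := by
    rw [Finset.sum_filter_of_ne]
    · rw [← (Fin.consEquiv fun _ : Fin (n + 1) => Fin 3).sum_comp, Fintype.sum_prod_type]
      refine Finset.sum_congr rfl fun m _ => ?_
      rw [← sum_prod_stepWeight, Finset.mul_sum]
      simp [Fin.consEquiv]
    · intro k _ hne
      by_contra hk
      exact hne (by rw [prod_stepWeight_eq_zero u k fun h => hk fun i i' => @h i i', mul_zero])
  have hterm (k : Fin (n + 1) → Fin 3) := chain_summand_eq u k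
  have hzero (k : Fin (n + 1) → Fin 3) : extSeq (n + 1) k 0 = k 0 := extSeq_val k 0
  have h6 : u ^ (6 : ℤ) = u ^ 6 := zpow_natCast u 6
  have h12 : u ^ (12 : ℤ) = u ^ 12 := zpow_natCast u 12
  calc
    _ = ∑ k ∈ Finset.univ.filter
        (fun k : Fin (n + 1) → Fin 3 => ∀ i i' : Fin (n + 1), i ≤ i' → k i' ≤ k i),
        (qbinom (u : R) 2 (k 0) * ((u ^ (6 * ((k 0 : ℕ) : ℤ)) : Rˣ) : R) *
          ∏ i ∈ Finset.range (k 0), (1 - a ^ 2 * ((u ^ (2 * (i : ℤ) - 2) : Rˣ) : R))) *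
        ∏ i : Fin n, stepWeight u (k i.castSucc) (k i.succ) := by
      refine Finset.sum_congr rfl fun k _ => ?_
      rw [Nat.add_sub_cancel, mul_assoc (qbinom _ _ _), hterm, hzero]
      ring
    _ = 1 + (1 - a ^ 2 * ((u ^ (-2 : ℤ) : Rˣ) : R)) * (1 + (u : R) ^ 2) *
          ((u : R) ^ 6 * chainWeight u n 1) +
        (1 - a ^ 2 * ((u ^ (-2 : ℤ) : Rˣ) : R)) * (1 - a ^ 2) *
          ((u : R) ^ 12 * chainWeight u n 2) := by
      rw [hsum fun m => qbinom (u : R) 2 m * ((u ^ (6 * ((m : ℕ) : ℤ)) : Rˣ) : R) *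
          ∏ i ∈ Finset.range m, (1 - a ^ 2 * ((u ^ (2 * (i : ℤ) - 2) : Rˣ) : R))]
      simp [Fin.sum_univ_three, qbinom, chainWeight_zero_right, Finset.prod_range_succ, h6, h12]
      ring
    _ = _ := by
      rw [mul_chainWeight_two_right, chainWeight_one_right, Finset.mul_sum,
        sum_Icc_one_eq_sum_range, sum_Icc_one_eq_sum_range,
        sum_filter_add_le_eq_sum_range fun x y => (u : R) ^ (12 * x + 8 * y - 2)]
      have h8 (β : ℕ) : 8 * (β + 1) - 2 = 6 + 8 * β := by omega
      have h20 (α β : ℕ) : 12 * (α + 1) + 8 * (β + 1) - 2 = 12 * (α + 1) + (8 * β + 6) := by omega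
      simp only [h8, h20, pow_add (u : R) 6]
      ring
end
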